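/- arXiv:math-ph/0611002 — 4 statements merged into one kernel-verified Lean document; each statement's English description precedes it below -/
import Mathlib

section
/- Let (H₀, H, H₀*) be a Hilbert triplet (H₀ continuously and densely embedded in H, and H continuously and densely embedded in the conjugate space H₀*), with the embedding H₀ ↪ H compact. Let a(u,v) be a bounded bilinear form on H₀ which is coercive relative to H, i.e., there exist λ > 0 and α₀ > 0 with a(u,u) + λ‖u‖²_H ≥ α₀‖u‖²_{H₀} for all u ∈ H₀. Then the variational problem: find u ∈ H₀ with a(u,v) = q(v) for all v ∈ H₀, admits a unique solution u for every q ∈ H₀* if and only if it admits the unique solution u = 0 for q = 0; and in that case the solution satisfies ‖u‖_{H₀} ≤ C‖q‖_{H₀*} with C independent of q. -/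
noncomputable section
open MeasureTheory Real Filter

/-- An injective compact perturbation of a continuous linear equivalence is bijective. -/
theorem ContinuousLinearEquiv.bijective_sub_of_isCompactOperator
    {𝕜 X Y : Type*} [NontriviallyNormedField 𝕜]
    [NormedAddCommGroup X] [NormedSpace 𝕜 X] [CompleteSpace X]
    [NormedAddCommGroup Y] [NormedSpace 𝕜 Y]
    (L : X ≃L[𝕜] Y) {K : X →L[𝕜] Y} (hK : IsCompactOperator K)
    (hinj : ∀ x, L x = K x → x = 0) :
    Function.Bijective ((L : X →L[𝕜] Y) - K) := by
  set T : X →L[𝕜] X := (L.symm : Y →L[𝕜] X) ∘L K with hT_def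
  have hT : IsCompactOperator T := hK.clm_comp (L.symm : Y →L[𝕜] X)
  have hbij : Function.Bijective (1 - T : X →L[𝕜] X) := by
    rw [← ContinuousLinearMap.isUnit_iff_bijective]
    have hres : (1 : 𝕜) ∈ resolventSet 𝕜 T := by
      refine (hT.hasEigenvalue_or_mem_resolventSet one_ne_zero).resolve_left fun h => ?_
      obtain ⟨x, hx⟩ := h.exists_hasEigenvector
      have hTx : L.symm (K x) = x := by simpa [hT_def] using hx.apply_eq_smul
      exact hx.2 (hinj x (by rw [← L.symm_apply_eq.mp hTx]))
    simpa [spectrum.mem_resolventSet_iff] using hres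
  have hcomp : ⇑((L : X →L[𝕜] Y) - K) = L ∘ ⇑(1 - T : X →L[𝕜] X) := by
    ext x
    simp [hT_def]
  rw [hcomp]
  exact L.bijective.comp hbij

/-- A bounded bilinear form on a Hilbert space which is coercive up to a compact term, and whose
left kernel is trivial, is represented by a continuous linear equivalence. -/
theorem exists_continuousLinearEquiv_of_coercive_add_compact
    {H₀ H : Type*}
    [NormedAddCommGroup H₀] [InnerProductSpace ℝ H₀] [CompleteSpace H₀]
    [NormedAddCommGroup H] [InnerProductSpace ℝ H] [CompleteSpace H]
    {E : H₀ →L[ℝ] H} (hE : IsCompactOperator E) (A : H₀ →L[ℝ] H₀ →L[ℝ] ℝ)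
    {lam α₀ : ℝ} (hα₀ : 0 < α₀)
    (hcoer : ∀ u : H₀, α₀ * ‖u‖ ^ 2 ≤ A u u + lam * ‖E u‖ ^ 2)
    (hker : ∀ u : H₀, (∀ v : H₀, A u v = 0) → u = 0) :
    ∃ S : H₀ ≃L[ℝ] H₀, ∀ u v : H₀, inner ℝ (S u) v = A u v := by
  set K : H₀ →L[ℝ] H₀ := (lam • ContinuousLinearMap.adjoint E) ∘L E with hK_def
  have hK : IsCompactOperator K := hE.clm_comp (lam • ContinuousLinearMap.adjoint E)
  have hK_inner (u v : H₀) : inner ℝ (K u) v = lam * inner ℝ (E u) (E v) := by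
    simp [hK_def, inner_smul_left, ContinuousLinearMap.adjoint_inner_left]
  set B : H₀ →L[ℝ] H₀ →L[ℝ] ℝ := A + (innerSL ℝ : H₀ →L[ℝ] H₀ →L[ℝ] ℝ) ∘L K
  have hB_apply (u v : H₀) : B u v = A u v + inner ℝ (K u) v := rfl
  have hB : IsCoercive B := by
    refine ⟨α₀, hα₀, fun u => ?_⟩
    rw [hB_apply, hK_inner, real_inner_self_eq_norm_sq, mul_assoc, ← sq]
    exact hcoer u
  set L := hB.continuousLinearEquivOfBilin
  have hLK (u v : H₀) : inner ℝ (L u - K u) v = A u v := by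
    rw [inner_sub_left, hB.continuousLinearEquivOfBilin_apply, hB_apply, add_sub_cancel_right]
  have hbij := L.bijective_sub_of_isCompactOperator hK fun u hu =>
    hker u fun v => by rw [← hLK, hu, sub_self, inner_zero_left]
  exact ⟨.ofBijective _ (LinearMap.ker_eq_bot.mpr hbij.1) (LinearMap.range_eq_top.mpr hbij.2), hLK⟩

/-- Let `(H₀, H, H₀*)` be a Hilbert triplet (`H₀` continuously and densely
embedded in `H` via `E`, which induces the dense embedding of `H` into `H₀*`), with the
embedding `H₀ ↪ H` compact.  Let `a` be a bounded bilinear form on `H₀` which is coercive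
relative to `H`.  Then the variational problem `a(u,v) = q(v)` for all `v ∈ H₀` admits a
unique solution `u ∈ H₀` for every `q ∈ H₀*` if and only if it admits the unique solution
`u = 0` for `q = 0`; and in that case the solution satisfies `‖u‖_{H₀} ≤ C‖q‖_{H₀*}` with
`C` independent of `q`. -/
theorem hilbert_triplet_fredholm_alternative
    {H₀ H : Type*}
    [NormedAddCommGroup H₀] [InnerProductSpace ℝ H₀] [CompleteSpace H₀]
    [NormedAddCommGroup H] [InnerProductSpace ℝ H] [CompleteSpace H]
    (E : H₀ →L[ℝ] H) (hE_inj : Function.Injective E) (hE_dense : DenseRange E)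
    (hE_compact : IsCompactOperator E)
    (a : H₀ →ₗ[ℝ] H₀ →ₗ[ℝ] ℝ)
    (M : ℝ) (hM : 0 < M) (ha_bdd : ∀ u v : H₀, |a u v| ≤ M * ‖u‖ * ‖v‖)
    (lam α₀ : ℝ) (hlam : 0 < lam) (hα₀ : 0 < α₀)
    (ha_coercive : ∀ u : H₀, α₀ * ‖u‖ ^ 2 ≤ a u u + lam * ‖E u‖ ^ 2) :
    ((∀ q : H₀ →L[ℝ] ℝ, ∃! u : H₀, ∀ v : H₀, a u v = q v) ↔
      (∀ u : H₀, (∀ v : H₀, a u v = 0) → u = 0)) ∧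
    ((∀ u : H₀, (∀ v : H₀, a u v = 0) → u = 0) →
      ∃ C : ℝ, 0 < C ∧ ∀ (q : H₀ →L[ℝ] ℝ) (u : H₀),
        (∀ v : H₀, a u v = q v) → ‖u‖ ≤ C * ‖q‖) := by
  have main (hker : ∀ u : H₀, (∀ v : H₀, a u v = 0) → u = 0) :
      ∃ S : H₀ ≃L[ℝ] H₀, ∀ (q : H₀ →L[ℝ] ℝ) (u : H₀),
        (∀ v : H₀, a u v = q v) ↔ u = S.symm ((InnerProductSpace.toDual ℝ H₀).symm q) := by
    obtain ⟨S, hS⟩ := exists_continuousLinearEquiv_of_coercive_add_compact hE_compact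
      (a.mkContinuous₂ M ha_bdd) hα₀ ha_coercive hker
    refine ⟨S, fun q u => ?_⟩
    rw [S.eq_symm_apply, ext_iff_inner_right ℝ]
    refine forall_congr' fun v => ?_
    rw [hS, InnerProductSpace.toDual_symm_apply, LinearMap.mkContinuous₂_apply]
  refine ⟨⟨fun h u hu => ?_, fun hker q => ?_⟩, fun hker => ?_⟩
  · exact (h 0).unique hu fun v => by simp
  · obtain ⟨S, hS⟩ := main hker
    exact ⟨_, (hS q _).mpr rfl, fun u hu => (hS q u).mp hu⟩
  · obtain ⟨S, hS⟩ := main hker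
    refine ⟨‖(S.symm : H₀ →L[ℝ] H₀)‖ + 1, by positivity, fun q u hu => ?_⟩
    rw [(hS q u).mp hu]
    calc ‖S.symm ((InnerProductSpace.toDual ℝ H₀).symm q)‖
        ≤ ‖(S.symm : H₀ →L[ℝ] H₀)‖ * ‖(InnerProductSpace.toDual ℝ H₀).symm q‖ :=
          (S.symm : H₀ →L[ℝ] H₀).le_opNorm _
      _ = ‖(S.symm : H₀ →L[ℝ] H₀)‖ * ‖q‖ := by rw [LinearIsometryEquiv.norm_map]
      _ ≤ (‖(S.symm : H₀ →L[ℝ] H₀)‖ + 1) * ‖q‖ := by gcongr; linarith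
end
end

section
/- Let Λ be a finite set with m = |Λ|, and let Φ ∈ C^∞(ℝ^Λ) satisfy: |∇Φ(x)| → ∞ as |x| → ∞; all derivatives ∂^αΦ of some fixed order M are bounded; for every multi-index α with |α| ≥ 1 there is C_α with |∂^αΦ(x)| ≤ C_α(1 + |∇Φ(x)|²)^{1/2}; and Hess Φ ≥ δ for some 0 < δ ≤ 1. Then the bilinear form b(u,w) = ∫_{ℝ^Λ} Du·Dw dx + ∫_{ℝ^Λ} (|∇Φ|²/4 − ΔΦ/2) u w dx on B¹_{0,Φ}(ℝ^Λ) satisfies the Gårding-type inequality δ'‖u‖²_{B¹_Φ(ℝ^Λ)} ≤ b(u,u) + γ‖u‖²_{L²(ℝ^Λ)} for all u ∈ B¹_{0,Φ}(ℝ^Λ), for some constants δ', γ > 0. -/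
noncomputable section
open MeasureTheory Real Filter

/-- Partial derivative of `u` in the `i`-th coordinate direction. -/
def pd {Λ : Type*} [Fintype Λ] [DecidableEq Λ] (u : EuclideanSpace ℝ Λ → ℝ)
    (i : Λ) (x : EuclideanSpace ℝ Λ) : ℝ :=
  fderiv ℝ u x (EuclideanSpace.single i 1)

/-- Laplacian of `u` (sum of second partial derivatives). -/
def lap {Λ : Type*} [Fintype Λ] [DecidableEq Λ] (u : EuclideanSpace ℝ Λ → ℝ)
    (x : EuclideanSpace ℝ Λ) : ℝ :=
  ∑ i, pd (pd u i) i x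

/-- Hessian entry `∂_i ∂_j u (x)`. -/
def hess {Λ : Type*} [Fintype Λ] [DecidableEq Λ] (u : EuclideanSpace ℝ Λ → ℝ)
    (x : EuclideanSpace ℝ Λ) (i j : Λ) : ℝ :=
  pd (pd u j) i x

/-- The normalized Gibbs measure `Z⁻¹ e^{-Φ} dx`. -/
def gibbs {Λ : Type*} [Fintype Λ] (Φ : EuclideanSpace ℝ Λ → ℝ) :
    Measure (EuclideanSpace ℝ Λ) :=
  (ENNReal.ofReal (∫ x, Real.exp (-Φ x)))⁻¹ •
    ((volume : Measure (EuclideanSpace ℝ Λ)).withDensity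
      fun x => ENNReal.ofReal (Real.exp (-Φ x)))

theorem continuous_gradient {Λ : Type*} [Fintype Λ] {f : EuclideanSpace ℝ Λ → ℝ}
    (hf : ContDiff ℝ 1 f) :
    Continuous (gradient f) :=
  (InnerProductSpace.toDual ℝ (EuclideanSpace ℝ Λ)).symm.continuous.comp
    (hf.continuous_fderiv one_ne_zero)

section PointwiseBounds

variable {Λ : Type*} [Fintype Λ] [DecidableEq Λ]

theorem pd_pd_eq_iteratedFDeriv {f : EuclideanSpace ℝ Λ → ℝ} (hf : ContDiff ℝ 2 f)
    (i j : Λ) (x : EuclideanSpace ℝ Λ) :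
    pd (pd f i) j x =
      iteratedFDeriv ℝ 2 f x ![EuclideanSpace.single j 1, EuclideanSpace.single i 1] := by
  have hd : DifferentiableAt ℝ (fderiv ℝ f) x :=
    (hf.fderiv_right (m := 1) (by norm_num)).differentiable (by norm_num) x
  rw [iteratedFDeriv_two_apply]
  change fderiv ℝ (fun y => fderiv ℝ f y (EuclideanSpace.single i 1)) x
    (EuclideanSpace.single j 1) = _
  rw [fderiv_clm_apply hd (differentiableAt_const _)]
  simp

theorem lap_le_card_mul_norm_iteratedFDeriv {f : EuclideanSpace ℝ Λ → ℝ}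
    (hf : ContDiff ℝ 2 f) (x : EuclideanSpace ℝ Λ) :
    lap f x ≤ Fintype.card Λ * ‖iteratedFDeriv ℝ 2 f x‖ := by
  have h : ∀ i ∈ Finset.univ, pd (pd f i) i x ≤ ‖iteratedFDeriv ℝ 2 f x‖ := by
    intro i _
    rw [pd_pd_eq_iteratedFDeriv hf]
    refine (le_abs_self _).trans ?_
    simpa [Fin.prod_univ_two] using (iteratedFDeriv ℝ 2 f x).le_opNorm
      ![EuclideanSpace.single i (1 : ℝ), EuclideanSpace.single i 1]
  simpa [lap] using Finset.sum_le_card_nsmul _ _ _ h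

theorem continuous_lap {f : EuclideanSpace ℝ Λ → ℝ} (hf : ContDiff ℝ 2 f) :
    Continuous (lap f) := by
  refine continuous_finsetSum _ fun i _ => ?_
  rw [funext (pd_pd_eq_iteratedFDeriv hf i i)]
  exact (ContinuousMultilinearMap.apply ℝ (fun _ : Fin 2 => EuclideanSpace ℝ Λ) ℝ
    ![EuclideanSpace.single i 1, EuclideanSpace.single i 1]).continuous.comp
      (hf.continuous_iteratedFDeriv (m := 2) le_rfl)

end PointwiseBounds

/-- Under assumptions (1)–(4) on the Hamiltonian `Φ`, the bilinear form
`b(u,w) = ∫ Du·Dw + ∫ (|∇Φ|²/4 − ΔΦ/2) u w` satisfies the Gårding-type inequality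
`δ'‖u‖²_{B¹_Φ} ≤ b(u,u) + γ‖u‖²_{L²}` on `B¹_{0,Φ}(ℝ^Λ)` (stated on the dense subspace
`C_0^∞(ℝ^Λ)` of `B¹_{0,Φ}(ℝ^Λ)`), where
`‖u‖²_{B¹_Φ} = ∫ u² + ∫ |∇u|² + ∫ Z_Φ² u²` with `Z_Φ = |∇Φ|/2`. -/
theorem garding_inequality_witten_form
    {Λ : Type*} [Fintype Λ] [DecidableEq Λ]
    (Φ : EuclideanSpace ℝ Λ → ℝ) (hΦ : ContDiff ℝ (⊤ : ℕ∞) Φ)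
    (h1 : Tendsto (fun x => ‖gradient Φ x‖) (cocompact (EuclideanSpace ℝ Λ)) atTop)
    (h2 : ∃ (M : ℕ) (C : ℝ), ∀ x, ‖iteratedFDeriv ℝ M Φ x‖ ≤ C)
    (h3 : ∀ n : ℕ, 1 ≤ n → ∃ C : ℝ, ∀ x,
      ‖iteratedFDeriv ℝ n Φ x‖ ≤ C * Real.sqrt (1 + ‖gradient Φ x‖ ^ 2))
    (h4 : ∃ δ : ℝ, 0 < δ ∧ δ ≤ 1 ∧ ∀ x v,
      δ * ‖v‖ ^ 2 ≤ iteratedFDeriv ℝ 2 Φ x ![v, v]) :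
    ∃ δ' γ : ℝ, 0 < δ' ∧ 0 < γ ∧
      ∀ u : EuclideanSpace ℝ Λ → ℝ, ContDiff ℝ (⊤ : ℕ∞) u → HasCompactSupport u →
        δ' * ((∫ x, (u x) ^ 2) + (∫ x, ‖gradient u x‖ ^ 2) +
            ∫ x, (‖gradient Φ x‖ / 2) ^ 2 * (u x) ^ 2) ≤
          ((∫ x, ‖gradient u x‖ ^ 2) +
              ∫ x, (‖gradient Φ x‖ ^ 2 / 4 - lap Φ x / 2) * (u x) ^ 2) +
            γ * ∫ x, (u x) ^ 2 := by
  obtain ⟨C, hC⟩ := h3 2 one_le_two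
  have hΦ2 : ContDiff ℝ 2 Φ := mod_cast contDiff_infty.mp hΦ 2
  set K : ℝ := Fintype.card Λ * C with hK
  have hlap : ∀ x, lap Φ x ≤ K * √(1 + ‖gradient Φ x‖ ^ 2) := fun x =>
    (lap_le_card_mul_norm_iteratedFDeriv hΦ2 x).trans <| by
      rw [hK, mul_assoc]
      exact mul_le_mul_of_nonneg_left (hC x) (Nat.cast_nonneg _)
  refine ⟨1 / 2, 1 + K ^ 2 / 2, by norm_num, by positivity, fun u hu hcu => ?_⟩
  have hgΦ : Continuous (gradient Φ) := continuous_gradient (hΦ2.of_le one_le_two)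
  have hlapc := continuous_lap hΦ2
  have hcu2 : HasCompactSupport fun x => u x ^ 2 :=
    hcu.comp_left (g := fun t : ℝ => t ^ 2) (by simp)
  have hweight : ∀ w : EuclideanSpace ℝ Λ → ℝ, Continuous w →
      Integrable fun x => w x * u x ^ 2 := fun w hw =>
    (hw.mul (hu.continuous.pow 2)).integrable_of_hasCompactSupport hcu2.mul_left
  have hI : Integrable fun x => u x ^ 2 :=
    (hu.continuous.pow 2).integrable_of_hasCompactSupport hcu2
  have hIZ := hweight (fun x => (‖gradient Φ x‖ / 2) ^ 2) (by fun_prop)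
  have hIV := hweight (fun x => ‖gradient Φ x‖ ^ 2 / 4 - lap Φ x / 2) (by fun_prop)
  have hpot : 1 / 2 * (∫ x, u x ^ 2) + 1 / 2 * (∫ x, (‖gradient Φ x‖ / 2) ^ 2 * u x ^ 2) ≤
      (∫ x, (‖gradient Φ x‖ ^ 2 / 4 - lap Φ x / 2) * u x ^ 2) +
        (1 + K ^ 2 / 2) * ∫ x, u x ^ 2 := by
    simp only [← integral_const_mul]
    rw [← integral_add (hI.const_mul _) (hIZ.const_mul _), ← integral_add hIV (hI.const_mul _)]
    refine integral_mono ((hI.const_mul _).add (hIZ.const_mul _))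
      (hIV.add (hI.const_mul _)) fun x => ?_
    have hs : √(1 + ‖gradient Φ x‖ ^ 2) ^ 2 = 1 + ‖gradient Φ x‖ ^ 2 :=
      Real.sq_sqrt (by positivity)
    have hx : 0 ≤ ‖gradient Φ x‖ ^ 2 / 8 - lap Φ x / 2 + 1 / 2 + K ^ 2 / 2 := by
      nlinarith [hlap x, sq_nonneg (√(1 + ‖gradient Φ x‖ ^ 2) - 2 * K)]
    have := mul_nonneg hx (sq_nonneg (u x))
    dsimp only
    linarith
  have hgrad : 0 ≤ ∫ x, ‖gradient u x‖ ^ 2 := integral_nonneg fun x => sq_nonneg _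
  linarith
end
end

section
/- Let Ω be an exterior domain in ℝ^m (containing a neighborhood of infinity, with smooth internal boundary), let the potential v ∈ C^∞(Ω) satisfy liminf_{|x|→∞} v(x) ≥ E, and let φ be a smooth solution of (−Δ + v(x))φ = λφ in Ω with prescribed smooth boundary values on ∂Ω, where λ < E. Then for every ε > 0 there is a constant C_ε > 0 such that |φ(x)| ≤ C_ε e^{−√((E−λ−ε)/2) |x|} for all x ∈ Ω. -/
noncomputable section
open MeasureTheory Real Filter

section Calculus

theorem ContDiffAt.eventually_differentiableAt {F : Type*} [NormedAddCommGroup F]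
    [NormedSpace ℝ F] {u : F → ℝ} {x : F} (hu : ContDiffAt ℝ 2 u x) :
    ∀ᶠ y in nhds x, DifferentiableAt ℝ u y :=
  (hu.eventually (by simp)).mono fun _ h => h.differentiableAt (by simp)

variable {Λ : Type*} [Fintype Λ] [DecidableEq Λ] {u w : EuclideanSpace ℝ Λ → ℝ}
  {x : EuclideanSpace ℝ Λ}

theorem pd_eventuallyEq (h : u =ᶠ[nhds x] w) (i : Λ) : pd u i =ᶠ[nhds x] pd w i := by
  filter_upwards [h.fderiv (𝕜 := ℝ)] with y hy
  simp only [pd, hy]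

theorem lap_congr (h : u =ᶠ[nhds x] w) : lap u x = lap w x :=
  Finset.sum_congr rfl fun i _ => (pd_eventuallyEq (pd_eventuallyEq h i) i).eq_of_nhds

theorem ContDiffAt.pd {n m : WithTop ℕ∞} (hu : ContDiffAt ℝ n u x) (hmn : m + 1 ≤ n) (i : Λ) :
    ContDiffAt ℝ m (pd u i) x :=
  (hu.fderiv_right hmn).clm_apply contDiffAt_const

theorem ContDiffAt.differentiableAt_pd (hu : ContDiffAt ℝ 2 u x) (i : Λ) :
    DifferentiableAt ℝ (_root_.pd u i) x :=
  (hu.pd (m := 1) (by norm_num) i).differentiableAt (by simp)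

theorem lap_sub_const_mul (hu : ContDiffAt ℝ 2 u x) (hw : ContDiffAt ℝ 2 w x) (c : ℝ) :
    lap (fun y => u y - c * w y) x = lap u x - c * lap w x := by
  simp only [lap, Finset.mul_sum, ← Finset.sum_sub_distrib]
  refine Finset.sum_congr rfl fun i _ => ?_
  have h : pd (fun y => u y - c * w y) i =ᶠ[nhds x] fun y => pd u i y - c * pd w i y := by
    filter_upwards [hu.eventually_differentiableAt, hw.eventually_differentiableAt] with y h₁ h₂
    simp [pd, fderiv_fun_sub h₁ (h₂.const_mul c), fderiv_const_mul h₂]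
  rw [(pd_eventuallyEq h i).eq_of_nhds, pd,
    fderiv_fun_sub (hu.differentiableAt_pd i) ((hw.differentiableAt_pd i).const_mul c),
    fderiv_const_mul (hw.differentiableAt_pd i)]
  simp [pd]

theorem two_mul_mul_lap_le_lap_sq (hu : ContDiffAt ℝ 2 u x) :
    2 * u x * lap u x ≤ lap (fun y => u y ^ 2) x := by
  simp only [lap, Finset.mul_sum]
  refine Finset.sum_le_sum fun i _ => ?_
  have h : pd (fun y => u y ^ 2) i =ᶠ[nhds x] fun y => 2 * (u y * pd u i y) := by
    filter_upwards [hu.eventually_differentiableAt] with y h₁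
    simp [pd, fderiv_fun_pow 2 h₁, mul_assoc]
  have h₁ : DifferentiableAt ℝ u x := hu.differentiableAt (by simp)
  have h₂ := hu.differentiableAt_pd i
  rw [(pd_eventuallyEq h i).eq_of_nhds]
  have : pd (fun y => 2 * (u y * pd u i y)) i x
      = 2 * (u x * pd (pd u i) i x + pd u i x * pd u i x) := by
    rw [pd, fderiv_const_mul (h₁.fun_mul h₂), fderiv_fun_mul h₁ h₂]
    simp [pd]
    ring
  rw [this]
  nlinarith [mul_self_nonneg (pd u i x)]

theorem lap_nonpos_of_isLocalMax (hu : ContDiffAt ℝ 2 u x) (hmax : IsLocalMax u x) :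
    lap u x ≤ 0 := by
  refine Finset.sum_nonpos fun i _ => ?_
  by_contra! hpos
  set e : EuclideanSpace ℝ Λ := EuclideanSpace.single i 1
  set γ : ℝ → EuclideanSpace ℝ Λ := fun t => x + t • e
  have hγ (t : ℝ) : HasDerivAt γ e t := by
    simpa [γ] using ((hasDerivAt_id t).smul_const e).const_add x
  have hγ0 : γ 0 = x := by simp [γ]
  have hγt : Tendsto γ (nhds 0) (nhds x) := by
    simpa [hγ0] using (hγ 0).continuousAt.tendsto
  have hd : deriv (fun t => u (γ t)) =ᶠ[nhds 0] fun t => pd u i (γ t) := by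
    filter_upwards [hγt.eventually hu.eventually_differentiableAt] with t ht
    exact (ht.hasFDerivAt.comp_hasDerivAt t (hγ t)).deriv
  have hdd : deriv (deriv fun t => u (γ t)) 0 = pd (pd u i) i x := by
    rw [hd.deriv_eq]
    have := (hu.differentiableAt_pd i).hasFDerivAt
    rw [← hγ0] at this
    exact (this.comp_hasDerivAt 0 (hγ 0)).deriv.trans (by rw [hγ0]; rfl)
  have hmax' : IsLocalMax (fun t => u (γ t)) 0 := by
    simpa [IsLocalMax, IsMaxFilter, hγ0] using hγt.eventually hmax
  have hcont : ContinuousAt (fun t => u (γ t)) 0 :=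
    ContinuousAt.comp (f := γ) (by simpa [hγ0] using hu.continuousAt) (hγ 0).continuousAt
  have hmin : IsLocalMin (fun t => u (γ t)) 0 :=
    isLocalMin_of_deriv_deriv_pos (by rw [hdd]; exact hpos) hmax'.deriv_eq_zero hcont
  have hconst : (fun t => u (γ t)) =ᶠ[nhds 0] fun _ => u (γ 0) := by
    filter_upwards [hmax', hmin] with t h₁ h₂ using le_antisymm h₁ h₂
  have : deriv (deriv fun t => u (γ t)) 0 = 0 := by
    rw [hconst.deriv.deriv_eq]; simp
  exact hpos.ne' (hdd ▸ this)

end Calculus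

section Barrier

variable {Λ : Type*} [Fintype Λ]

/-- The Japanese bracket `√(1 + ‖x‖²)`, a smooth substitute for the norm. -/
def bracket (x : EuclideanSpace ℝ Λ) : ℝ := √(1 + ‖x‖ ^ 2)

theorem bracket_pos (x : EuclideanSpace ℝ Λ) : 0 < bracket x := by
  unfold bracket; positivity

theorem bracket_sq (x : EuclideanSpace ℝ Λ) : bracket x ^ 2 = 1 + ‖x‖ ^ 2 :=
  Real.sq_sqrt (by positivity)

theorem norm_le_bracket (x : EuclideanSpace ℝ Λ) : ‖x‖ ≤ bracket x :=
  Real.le_sqrt_of_sq_le (by linarith)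

theorem contDiff_bracket {n : WithTop ℕ∞} :
    ContDiff ℝ n (bracket : EuclideanSpace ℝ Λ → ℝ) :=
  (contDiff_const.add (contDiff_norm_sq ℝ)).sqrt fun x => by positivity

variable [DecidableEq Λ]

theorem pd_bracket (i : Λ) (x : EuclideanSpace ℝ Λ) : pd bracket i x = x i / bracket x := by
  have h : HasFDerivAt (fun y : EuclideanSpace ℝ Λ => 1 + ‖y‖ ^ 2) (2 • innerSL ℝ x) x :=
    (hasStrictFDerivAt_norm_sq x).hasFDerivAt.const_add 1
  have h' := (h.sqrt (by positivity)).fderiv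
  unfold pd
  change (fderiv ℝ (fun y : EuclideanSpace ℝ Λ => √(1 + ‖y‖ ^ 2)) x) _ = _
  rw [h']
  simp [bracket, EuclideanSpace.inner_single_right]
  field_simp

/-- `exp (-κ √(1 + ‖x‖²))` is a supersolution of `-Δ + κ²`. -/
theorem lap_exp_neg_mul_bracket_le {κ : ℝ} (hκ : 0 ≤ κ) (x : EuclideanSpace ℝ Λ) :
    lap (fun y => Real.exp (-κ * bracket y)) x ≤ κ ^ 2 * Real.exp (-κ * bracket x) := by
  have hb : Differentiable ℝ (bracket : EuclideanSpace ℝ Λ → ℝ) :=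
    contDiff_bracket.differentiable (n := 1) (by simp)
  have hpd (i : Λ) : pd (fun y => Real.exp (-κ * bracket y)) i
      = fun y => Real.exp (-κ * bracket y) * (-κ * (y i / bracket y)) := by
    funext y
    rw [← pd_bracket, pd, fderiv_exp ((hb y).const_mul _), fderiv_const_mul (hb y)]
    simp [pd]
  have hbx := bracket_pos x
  have hcoord (i : Λ) : HasFDerivAt (fun y : EuclideanSpace ℝ Λ => y i)
      (EuclideanSpace.proj i : EuclideanSpace ℝ Λ →L[ℝ] ℝ) x :=
    (EuclideanSpace.proj i : EuclideanSpace ℝ Λ →L[ℝ] ℝ).hasFDerivAt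
  have hpp (i : Λ) : pd (pd (fun y => Real.exp (-κ * bracket y)) i) i x
      = Real.exp (-κ * bracket x) * (κ ^ 2 * (x i ^ 2 / bracket x ^ 2)
        - κ * (1 / bracket x - x i ^ 2 / bracket x ^ 3)) := by
    have hE := (((hb x).hasFDerivAt.const_mul (-κ)).exp)
    have hq := (hcoord i).mul ((hasDerivAt_inv hbx.ne').comp_hasFDerivAt x (hb x).hasFDerivAt)
    have := (hE.mul (hq.const_mul (-κ))).fderiv
    rw [hpd, pd]
    erw [this]
    have hpb : fderiv ℝ bracket x (EuclideanSpace.single i 1) = x i / bracket x := pd_bracket i x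
    simp [hpb]
    field_simp
    ring
  have hsum : ∑ i, x i ^ 2 = ‖x‖ ^ 2 := (EuclideanSpace.real_norm_sq_eq x).symm
  have key (i : Λ) : x i ^ 2 / bracket x ^ 3 ≤ 1 / bracket x := by
    have h1 : x i ^ 2 ≤ bracket x ^ 2 := by
      rw [bracket_sq, ← hsum]
      have := Finset.single_le_sum (f := fun i => x i ^ 2) (fun j _ => sq_nonneg _)
        (Finset.mem_univ i)
      simp only at this; linarith
    rw [div_le_div_iff₀ (by positivity) hbx]
    nlinarith
  calc lap (fun y => Real.exp (-κ * bracket y)) x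
      ≤ ∑ i, Real.exp (-κ * bracket x) * (κ ^ 2 * (x i ^ 2 / bracket x ^ 2)) := by
        refine Finset.sum_le_sum fun i _ => ?_
        rw [hpp]
        gcongr
        have := mul_nonneg hκ (sub_nonneg.2 (key i))
        linarith
    _ = Real.exp (-κ * bracket x) * κ ^ 2 * (‖x‖ ^ 2 / bracket x ^ 2) := by
        rw [← hsum, Finset.sum_div, Finset.mul_sum]
        exact Finset.sum_congr rfl fun i _ => by ring
    _ ≤ Real.exp (-κ * bracket x) * κ ^ 2 * 1 := by
        gcongr
        rw [div_le_one (by positivity), bracket_sq]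
        linarith
    _ = _ := by ring

end Barrier

section MeanValue

theorem hasDerivAt_max_zero_sq (s : ℝ) :
    HasDerivAt (fun t : ℝ => max 0 t ^ 2) (2 * max 0 s) s := by
  rcases lt_trichotomy s 0 with hs | rfl | hs
  · have h : (fun t : ℝ => max 0 t ^ 2) =ᶠ[nhds s] fun _ => 0 := by
      filter_upwards [gt_mem_nhds hs] with t ht
      simp [max_eq_left ht.le]
    simpa [max_eq_left hs.le] using (hasDerivAt_const s (0 : ℝ)).congr_of_eventuallyEq h
  · have h : (fun t : ℝ => max 0 t ^ 2) =O[nhds 0] fun t => ‖t - 0‖ ^ 2 := by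
      refine Asymptotics.IsBigO.of_bound 1 (Eventually.of_forall fun t => ?_)
      rcases le_total t 0 with ht | ht <;> simp [ht, sq_nonneg]
    simpa using (h.hasFDerivAt (𝕜 := ℝ) one_lt_two).hasDerivAt
  · have h : (fun t : ℝ => max 0 t ^ 2) =ᶠ[nhds s] fun t => t ^ 2 := by
      filter_upwards [lt_mem_nhds hs] with t ht
      simp [max_eq_right ht.le]
    simpa [max_eq_right hs.le] using (hasDerivAt_pow 2 s).congr_of_eventuallyEq h

variable {Λ : Type*} [Fintype Λ]

/-- The averaging kernel `(1 - ‖y‖²)₊` on the unit ball. -/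
def ballKernel (y : EuclideanSpace ℝ Λ) : ℝ := max 0 (1 - ‖y‖ ^ 2)

theorem continuous_ballKernel : Continuous (ballKernel : EuclideanSpace ℝ Λ → ℝ) := by
  unfold ballKernel; fun_prop

theorem ballKernel_nonneg (y : EuclideanSpace ℝ Λ) : 0 ≤ ballKernel y := le_max_left _ _

theorem ballKernel_le_one (y : EuclideanSpace ℝ Λ) : ballKernel y ≤ 1 :=
  max_le zero_le_one (by nlinarith [sq_nonneg ‖y‖])

theorem ballKernel_eq_zero {y : EuclideanSpace ℝ Λ} (hy : 1 ≤ ‖y‖) : ballKernel y = 0 :=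
  max_eq_left (by nlinarith)

theorem hasCompactSupport_ballKernel :
    HasCompactSupport (ballKernel : EuclideanSpace ℝ Λ → ℝ) :=
  HasCompactSupport.intro (isCompact_closedBall 0 1) fun y hy =>
    ballKernel_eq_zero (by simpa using (not_le.1 (by simpa using hy)).le)

theorem integral_ballKernel_pos : 0 < ∫ y : EuclideanSpace ℝ Λ, ballKernel y :=
  continuous_ballKernel.integral_pos_of_hasCompactSupport_nonneg_nonzero
    hasCompactSupport_ballKernel ballKernel_nonneg (x := 0) (by simp [ballKernel])

theorem hasFDerivAt_ballKernel_sq (y : EuclideanSpace ℝ Λ) :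
    HasFDerivAt (fun z => ballKernel z ^ 2)
      ((2 * ballKernel y) • (-(2 • innerSL ℝ y) : EuclideanSpace ℝ Λ →L[ℝ] ℝ)) y :=
  HasDerivAt.comp_hasFDerivAt (h₂ := fun t : ℝ => max 0 t ^ 2)
    (f := fun z : EuclideanSpace ℝ Λ => 1 - ‖z‖ ^ 2) y (hasDerivAt_max_zero_sq _)
    ((hasStrictFDerivAt_norm_sq y).hasFDerivAt.const_sub 1)

variable [DecidableEq Λ]

theorem fderiv_ballKernel_sq_single (y : EuclideanSpace ℝ Λ) (i : Λ) :
    fderiv ℝ (fun z => ballKernel z ^ 2) y (EuclideanSpace.single i 1)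
      = -4 * (y i * ballKernel y) := by
  rw [(hasFDerivAt_ballKernel_sq y).fderiv]
  simp [EuclideanSpace.inner_single_right]
  ring

variable {W : EuclideanSpace ℝ Λ → ℝ}

theorem ContDiff.pd {n m : WithTop ℕ∞} (hW : ContDiff ℝ n W) (hmn : m + 1 ≤ n) (i : Λ) :
    ContDiff ℝ m (pd W i) :=
  contDiff_iff_contDiffAt.2 fun _ => hW.contDiffAt.pd hmn i

/-- Integration by parts against the averaging kernel. -/
theorem integral_fderiv_mul_ballKernel (hW : ContDiff ℝ 2 W) (x : EuclideanSpace ℝ Λ) (t : ℝ) :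
    ∫ y, fderiv ℝ W (x + t • y) y * ballKernel y
      = t / 4 * ∫ y, lap W (x + t • y) * ballKernel y ^ 2 := by
  have hpd (i : Λ) : ContDiff ℝ 1 (pd W i) := hW.pd (by norm_num) i
  have hline : Continuous fun y : EuclideanSpace ℝ Λ => x + t • y := by fun_prop
  have hcpt {f g : EuclideanSpace ℝ Λ → ℝ} (hf : Continuous f) (hg : Continuous g)
      (hz : ∀ y, 1 ≤ ‖y‖ → g y = 0) : Integrable fun y => f y * g y := by
    refine (hf.mul hg).integrable_of_hasCompactSupport ?_
    exact HasCompactSupport.intro (isCompact_closedBall 0 1) fun y hy => by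
      simp [hz y (by simpa using (not_le.1 (by simpa using hy)).le)]
  have hfd (i : Λ) (y : EuclideanSpace ℝ Λ) :
      HasFDerivAt (fun z => pd W i (x + t • z))
        (t • fderiv ℝ (pd W i) (x + t • y)) y := by
    have h := ((hpd i).differentiable (by simp) (x + t • y)).hasFDerivAt.comp y
      (((hasFDerivAt_id y).const_smul t).const_add x)
    rwa [ContinuousLinearMap.comp_smul, ContinuousLinearMap.comp_id] at h
  have hfd' (i : Λ) (y : EuclideanSpace ℝ Λ) :
      fderiv ℝ (fun z => pd W i (x + t • z)) y (EuclideanSpace.single i 1)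
        = t * pd (pd W i) i (x + t • y) := by
    rw [(hfd i y).fderiv]; rfl
  have hpp (i : Λ) : Continuous (pd (pd W i) i) :=
    ((hpd i).pd (m := 0) (by norm_num) i).continuous
  have hK : Continuous fun y : EuclideanSpace ℝ Λ => ballKernel y ^ 2 :=
    continuous_ballKernel.pow 2
  have hKz (y : EuclideanSpace ℝ Λ) (hy : 1 ≤ ‖y‖) : ballKernel y ^ 2 = 0 := by
    simp [ballKernel_eq_zero hy]
  have hcoord (i : Λ) : Continuous fun y : EuclideanSpace ℝ Λ => y i :=
    (EuclideanSpace.proj i : EuclideanSpace ℝ Λ →L[ℝ] ℝ).continuous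
  have hint₁ (i : Λ) : Integrable fun y : EuclideanSpace ℝ Λ =>
      pd W i (x + t • y) * (y i * ballKernel y) :=
    hcpt ((hpd i).continuous.comp hline) ((hcoord i).mul continuous_ballKernel)
      fun y hy => by simp [ballKernel_eq_zero hy]
  have hint₂ (i : Λ) : Integrable fun y : EuclideanSpace ℝ Λ =>
      pd (pd W i) i (x + t • y) * ballKernel y ^ 2 :=
    hcpt ((hpp i).comp hline) hK hKz
  have hparts (i : Λ) : ∫ y, pd W i (x + t • y) * (y i * ballKernel y)
      = t / 4 * ∫ y, pd (pd W i) i (x + t • y) * ballKernel y ^ 2 := by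
    have h := integral_mul_fderiv_eq_neg_fderiv_mul_of_integrable
      (μ := (volume : Measure (EuclideanSpace ℝ Λ)))
      (f := fun z => pd W i (x + t • z)) (g := fun z => ballKernel z ^ 2)
      (v := EuclideanSpace.single i 1)
      (by simpa only [hfd', mul_assoc] using (hint₂ i).const_mul t)
      (by
        simp only [fderiv_ballKernel_sq_single]
        convert (hint₁ i).const_mul (-4) using 2
        ring)
      (hcpt ((hpd i).continuous.comp hline) hK hKz)
      (fun y _ => (hfd i y).differentiableAt)
      (fun y _ => (hasFDerivAt_ballKernel_sq y).differentiableAt)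
    simp only [fderiv_ballKernel_sq_single, hfd', mul_assoc, mul_left_comm _ (-4 : ℝ),
      integral_const_mul] at h
    linarith
  calc ∫ y, fderiv ℝ W (x + t • y) y * ballKernel y
      = ∫ y, ∑ i, pd W i (x + t • y) * (y i * ballKernel y) := by
        congr 1; funext y
        have hy : fderiv ℝ W (x + t • y) y = ∑ i, y i * pd W i (x + t • y) := by
          conv_lhs => enter [2]; rw [← (EuclideanSpace.basisFun Λ ℝ).sum_repr y]
          simp [pd, map_sum]
        rw [hy, Finset.sum_mul]
        exact Finset.sum_congr rfl fun i _ => by ring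
    _ = ∑ i, t / 4 * ∫ y, pd (pd W i) i (x + t • y) * ballKernel y ^ 2 := by
        rw [integral_finsetSum _ fun i _ => hint₁ i]
        exact Finset.sum_congr rfl fun i _ => hparts i
    _ = _ := by
        rw [← Finset.mul_sum, ← integral_finsetSum _ fun i _ => hint₂ i]
        simp only [lap, Finset.sum_mul]

/-- The weighted mean value inequality for functions subharmonic on a unit ball. -/
theorem mul_integral_ballKernel_le (hW : ContDiff ℝ 2 W) (x : EuclideanSpace ℝ Λ)
    (hlap : ∀ y ∈ Metric.ball x 1, 0 ≤ lap W y) :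
    W x * ∫ y : EuclideanSpace ℝ Λ, ballKernel y ≤ ∫ y, W (x + y) * ballKernel y := by
  set B : Set (EuclideanSpace ℝ Λ) := Metric.closedBall 0 1
  have hB : IsCompact B := isCompact_closedBall 0 1
  have hout {y : EuclideanSpace ℝ Λ} (hy : y ∉ B) : ballKernel y = 0 :=
    ballKernel_eq_zero (by simpa using (not_le.1 (by simpa [B] using hy)).le)
  have hset (f : EuclideanSpace ℝ Λ → ℝ) :
      ∫ y in B, f y * ballKernel y = ∫ y, f y * ballKernel y :=
    setIntegral_eq_integral_of_forall_compl_eq_zero fun y hy => by rw [hout hy, mul_zero]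
  have hfc : Continuous (fderiv ℝ W) := hW.continuous_fderiv (by simp)
  have hker := continuous_ballKernel (Λ := Λ)
  have hderiv (t : ℝ) : HasDerivAt (fun s : ℝ => ∫ y in B, W (x + s • y) * ballKernel y)
      (∫ y in B, fderiv ℝ W (x + t • y) y * ballKernel y) t := by
    have hjoint : Continuous fun p : ℝ × EuclideanSpace ℝ Λ =>
        fderiv ℝ W (x + p.1 • p.2) p.2 * ballKernel p.2 :=
      ((hfc.comp (by fun_prop)).clm_apply continuous_snd).mul (hker.comp continuous_snd)
    obtain ⟨C, hC⟩ := ((isCompact_closedBall t 1).prod hB).exists_bound_of_continuousOn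
      hjoint.continuousOn
    have hcont (s : ℝ) : Continuous fun y => W (x + s • y) * ballKernel y :=
      (hW.continuous.comp (by fun_prop)).mul hker
    refine (hasDerivAt_integral_of_dominated_loc_of_deriv_le (bound := fun _ => C)
      (F' := fun s y => fderiv ℝ W (x + s • y) y * ballKernel y)
      (Metric.closedBall_mem_nhds t one_pos)
      (Eventually.of_forall fun s => (hcont s).aestronglyMeasurable)
      ((hcont t).continuousOn.integrableOn_compact hB)
      (Continuous.aestronglyMeasurable (hjoint.comp (Continuous.prodMk_right t)))
      ?_ ?_ ?_).2
    · filter_upwards [ae_restrict_mem hB.measurableSet] with y hy s hs using hC (s, y) ⟨hs, hy⟩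
    · exact integrableOn_const hB.measure_lt_top.ne
    · refine Eventually.of_forall fun y s _ => HasDerivAt.mul_const ?_ _
      have hl : HasDerivAt (fun s : ℝ => x + s • y) y s := by
        simpa using ((hasDerivAt_id s).smul_const y).const_add x
      exact (hW.differentiable (by simp) (x + s • y)).hasFDerivAt.comp_hasDerivAt s hl
  have hmono := monotoneOn_of_deriv_nonneg (convex_Icc (0 : ℝ) 1)
    (fun t _ => (hderiv t).continuousAt.continuousWithinAt)
    (fun t _ => (hderiv t).differentiableAt.differentiableWithinAt) (fun t ht => by
      rw [interior_Icc] at ht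
      rw [(hderiv t).deriv, hset, integral_fderiv_mul_ballKernel hW]
      refine mul_nonneg (by linarith [ht.1]) (integral_nonneg fun y => ?_)
      rcases le_or_gt 1 ‖y‖ with hy | hy
      · simp [ballKernel_eq_zero hy]
      · refine mul_nonneg (hlap _ ?_) (sq_nonneg _)
        rw [mem_ball_iff_norm, add_sub_cancel_left, norm_smul, Real.norm_of_nonneg ht.1.le]
        nlinarith [ht.1, ht.2, norm_nonneg y])
  have h01 := hmono (Set.left_mem_Icc.2 zero_le_one) (Set.right_mem_Icc.2 zero_le_one) zero_le_one
  simp only [hset] at h01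
  simpa [integral_const_mul] using h01

/-- A nonnegative `C²` function which is subharmonic on a ball of radius `2` is controlled at the
center by its integral over the concentric unit ball. -/
theorem mul_integral_ballKernel_le_setIntegral {w : EuclideanSpace ℝ Λ → ℝ}
    {x : EuclideanSpace ℝ Λ} (hw : ∀ y ∈ Metric.ball x 2, ContDiffAt ℝ 2 w y)
    (hnonneg : ∀ y, 0 ≤ w y) (hlap : ∀ y ∈ Metric.ball x 2, 0 ≤ lap w y) :
    w x * ∫ y : EuclideanSpace ℝ Λ, ballKernel y ≤ ∫ y in Metric.closedBall x 1, w y := by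
  let χ : ContDiffBump x := ⟨3 / 2, 7 / 4, by norm_num, by norm_num⟩
  set W : EuclideanSpace ℝ Λ → ℝ := fun y => χ y * w y
  have hWw {y} (hy : y ∈ Metric.ball x (3 / 2)) : W =ᶠ[nhds y] w := by
    filter_upwards [Metric.isOpen_ball.mem_nhds hy] with z hz
    have : χ z = 1 := χ.one_of_mem_closedBall (Metric.ball_subset_closedBall hz)
    simp [W, this]
  have hW : ContDiff ℝ 2 W := by
    refine contDiff_iff_contDiffAt.2 fun y => ?_
    by_cases hy : y ∈ Metric.ball x 2
    · exact χ.contDiffAt.mul (hw y hy)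
    · have hy' : y ∈ (Metric.closedBall x (7 / 4))ᶜ := by
        simp only [Metric.mem_ball, not_lt, Set.mem_compl_iff, Metric.mem_closedBall,
          not_le] at hy ⊢
        linarith
      refine contDiffAt_const (c := (0 : ℝ)).congr_of_eventuallyEq ?_
      filter_upwards [Metric.isClosed_closedBall.isOpen_compl.mem_nhds hy'] with z hz
      have : χ z = 0 := χ.zero_of_le_dist (by simpa using (not_le.1 (by simpa using hz)).le)
      simp [W, this]
  have hmv := mul_integral_ballKernel_le hW x fun y hy => by
    have hy' : y ∈ Metric.ball x (3 / 2) := Metric.ball_subset_ball (by norm_num) hy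
    rw [lap_congr (hWw hy')]
    exact hlap y (Metric.ball_subset_ball (by norm_num) hy)
  have hx : W x = w x := (hWw (Metric.mem_ball_self (by norm_num))).eq_of_nhds
  have heqOn {y} (hy : y ∈ Metric.closedBall x 1) : W y = w y :=
    (hWw (Metric.closedBall_subset_ball (by norm_num) hy)).eq_of_nhds
  rw [hx] at hmv
  refine hmv.trans ?_
  have hshift : ∫ y, W (x + y) * ballKernel y = ∫ y, W y * ballKernel (y - x) := by
    rw [← integral_add_left_eq_self (fun y => W y * ballKernel (y - x)) x]
    simp
  have hzero (y) (hy : y ∉ Metric.closedBall x 1) : W y * ballKernel (y - x) = 0 := by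
    rw [ballKernel_eq_zero, mul_zero]
    rw [← dist_eq_norm]
    simpa using (not_le.1 (by simpa using hy)).le
  rw [hshift, ← setIntegral_eq_integral_of_forall_compl_eq_zero hzero,
    ← setIntegral_congr_fun Metric.isClosed_closedBall.measurableSet fun y hy => heqOn hy]
  have hK : Continuous fun y => ballKernel (y - x) :=
    continuous_ballKernel.comp (continuous_id.sub continuous_const)
  refine setIntegral_mono_on ?_ ?_ Metric.isClosed_closedBall.measurableSet fun y hy => ?_
  · exact (hW.continuous.mul hK).continuousOn.integrableOn_compact (isCompact_closedBall x 1)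
  · exact hW.continuous.continuousOn.integrableOn_compact (isCompact_closedBall x 1)
  · rw [heqOn hy]
    exact mul_le_of_le_one_right (hnonneg y) (ballKernel_le_one _)

end MeanValue

section Exterior

variable {Λ : Type*} [Fintype Λ] [DecidableEq Λ] {R : ℝ}

/-- The maximum principle on the complement of a ball. -/
theorem nonpos_of_lap_pos {h : EuclideanSpace ℝ Λ → ℝ}
    (hcd : ∀ x, R ≤ ‖x‖ → ContDiffAt ℝ 2 h x) (hbd : ∀ x, ‖x‖ = R → h x ≤ 0)
    (hinf : ∀ η, 0 < η → ∀ᶠ x in cocompact (EuclideanSpace ℝ Λ), h x < η)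
    (hlap : ∀ x, R < ‖x‖ → 0 < h x → 0 < lap h x) (x : EuclideanSpace ℝ Λ) (hx : R ≤ ‖x‖) :
    h x ≤ 0 := by
  by_contra! hpos
  obtain ⟨K, hK, hKsub⟩ := Filter.mem_cocompact.1 (hinf _ hpos)
  have hclosed : IsClosed {y : EuclideanSpace ℝ Λ | R ≤ ‖y‖} :=
    isClosed_le continuous_const continuous_norm
  have hcompact : IsCompact ({y : EuclideanSpace ℝ Λ | R ≤ ‖y‖} ∩ K) := hK.inter_left hclosed
  have hxK : x ∈ K := by
    by_contra hxK
    exact lt_irrefl (h x) (hKsub hxK)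
  obtain ⟨z, ⟨hzR, hzK⟩, hz⟩ := hcompact.exists_isMaxOn ⟨x, hx, hxK⟩
    fun y hy => (hcd y hy.1).continuousAt.continuousWithinAt
  have hxz : h x ≤ h z := hz ⟨hx, hxK⟩
  have hzpos : 0 < h z := hpos.trans_le hxz
  have hRz : R < ‖z‖ := lt_of_le_of_ne hzR fun heq => (hbd z heq.symm).not_gt hzpos
  have hmax : IsLocalMax h z := by
    filter_upwards [continuous_norm.continuousAt.eventually (lt_mem_nhds hRz)] with y hy
    by_cases hyK : y ∈ K
    · exact hz ⟨hy.le, hyK⟩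
    · exact (hKsub hyK).le.trans hxz
  exact (hlap z hRz hzpos).not_ge (lap_nonpos_of_isLocalMax (hcd z hzR) hmax)

/-- A nonnegative integrable function which is subharmonic near infinity vanishes at infinity. -/
theorem tendsto_zero_of_subharmonic {w : EuclideanSpace ℝ Λ → ℝ} (hnonneg : ∀ x, 0 ≤ w x)
    (hcd : ∀ x, R ≤ ‖x‖ → ContDiffAt ℝ 2 w x) (hlap : ∀ x, R ≤ ‖x‖ → 0 ≤ lap w x)
    (hint : IntegrableOn w {x | R ≤ ‖x‖}) :
    Tendsto w (cocompact (EuclideanSpace ℝ Λ)) (nhds 0) := by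
  set c := ∫ y : EuclideanSpace ℝ Λ, ballKernel y
  have hc : 0 < c := integral_ballKernel_pos
  set T : ℝ → ℝ := fun r => ∫ y in {y : EuclideanSpace ℝ Λ | r ≤ ‖y‖}, w y
  have hmeas (r : ℝ) : MeasurableSet {y : EuclideanSpace ℝ Λ | r ≤ ‖y‖} :=
    (isClosed_le continuous_const continuous_norm).measurableSet
  have hT : Tendsto T atTop (nhds 0) := by
    have h := tendsto_setIntegral_of_antitone (μ := volume) (f := w)
      (s := fun r : ℝ => {y : EuclideanSpace ℝ Λ | r ≤ ‖y‖}) hmeas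
      (fun r s hrs y hy => le_trans hrs hy) ⟨R, hint⟩
    have hempty : ⋂ r : ℝ, {y : EuclideanSpace ℝ Λ | r ≤ ‖y‖} = ∅ := by
      ext y
      simp only [Set.mem_iInter, Set.mem_ofPred_eq, Set.mem_empty_iff_false, iff_false, not_forall]
      exact ⟨‖y‖ + 1, by linarith⟩
    simpa [hempty] using h
  have hnorm : Tendsto (fun x : EuclideanSpace ℝ Λ => ‖x‖) (cocompact _) atTop :=
    tendsto_norm_cocompact_atTop
  have hbound : Tendsto (fun x : EuclideanSpace ℝ Λ => T (‖x‖ - 1) / c) (cocompact _)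
      (nhds 0) := by
    simpa [sub_eq_add_neg] using (hT.comp (tendsto_atTop_add_const_right _ (-1) hnorm)).div_const c
  refine tendsto_of_tendsto_of_tendsto_of_le_of_le' tendsto_const_nhds hbound
    (Eventually.of_forall hnonneg) ?_
  filter_upwards [hnorm.eventually_ge_atTop (R + 2)] with x hx
  have hfar {y : EuclideanSpace ℝ Λ} (hy : y ∈ Metric.ball x 2) : R ≤ ‖y‖ := by
    rw [mem_ball_iff_norm'] at hy
    linarith [norm_le_norm_add_norm_sub y x, norm_sub_rev x y]
  rw [le_div_iff₀ hc]
  refine (mul_integral_ballKernel_le_setIntegral (fun y hy => hcd y (hfar hy)) hnonneg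
    fun y hy => hlap y (hfar hy)).trans ?_
  refine setIntegral_mono_set (hint.mono_set fun y hy => ?_) (ae_of_all _ hnonneg)
    (LE.le.eventuallyLE fun y hy => ?_)
  · have : ‖x‖ - 1 ≤ ‖y‖ := hy
    change R ≤ ‖y‖
    linarith
  · rw [mem_closedBall_iff_norm'] at hy
    change ‖x‖ - 1 ≤ ‖y‖
    linarith [norm_le_norm_add_norm_sub y x, norm_sub_rev x y]

end Exterior

/-- Let `Ω ⊂ ℝ^m` be an exterior domain, `v ∈ C^∞(Ω)` with
`liminf_{|x|→∞} v(x) ≥ E`, and let `φ` be a smooth (square-integrable) solution of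
`(−Δ + v)φ = λφ` in `Ω`, continuous up to the boundary, with `λ < E`.  Then for every
`ε > 0` there is `C_ε > 0` with `|φ(x)| ≤ C_ε e^{−√((E−λ−ε)/2)|x|}` on `Ω`. -/
theorem exponential_decay_eigenfunctions
    {Λ : Type*} [Fintype Λ] [DecidableEq Λ]
    (Ω : Set (EuclideanSpace ℝ Λ)) (hΩo : IsOpen Ω) (hΩc : IsConnected Ω)
    (hΩext : IsCompact Ωᶜ)
    (v : EuclideanSpace ℝ Λ → ℝ) (hv : ContDiffOn ℝ (⊤ : ℕ∞) v Ω)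
    (E lam : ℝ) (hlam : lam < E)
    (hliminf : ∀ ε : ℝ, 0 < ε →
      ∀ᶠ x in cocompact (EuclideanSpace ℝ Λ), E - ε ≤ v x)
    (φ : EuclideanSpace ℝ Λ → ℝ)
    (hφ : ContDiffOn ℝ (⊤ : ℕ∞) φ Ω) (hφc : ContinuousOn φ (closure Ω))
    (hφL2 : IntegrableOn (fun x => (φ x) ^ 2) Ω volume)
    (heq : ∀ x ∈ Ω, -lap φ x + v x * φ x = lam * φ x) :
    ∀ ε : ℝ, 0 < ε → ∃ C : ℝ, 0 < C ∧ ∀ x ∈ Ω,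
      |φ x| ≤ C * Real.exp (-Real.sqrt ((E - lam - ε) / 2) * ‖x‖) := by
  intro ε hε
  obtain ⟨δ, hδ, hδε, hδE⟩ : ∃ δ, 0 < δ ∧ δ ≤ ε ∧ δ < E - lam :=
    ⟨min ε ((E - lam) / 2), by have := sub_pos.2 hlam; positivity, min_le_left _ _,
      (min_le_right _ _).trans_lt (by linarith)⟩
  obtain ⟨R, hR, hRΩ⟩ : ∃ R, 0 < R ∧ ∀ x, R ≤ ‖x‖ → x ∈ Ω ∧ E - δ ≤ v x := by
    have h := (hliminf δ hδ).and hΩext.compl_mem_cocompact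
    rw [Filter.Eventually, ← Metric.cobounded_eq_cocompact, ← comap_norm_atTop,
      Filter.mem_comap] at h
    obtain ⟨s, hs, hsub⟩ := h
    obtain ⟨a, ha⟩ := Filter.mem_atTop_sets.1 hs
    refine ⟨max a 1, by positivity, fun x hx => ?_⟩
    have := hsub (show x ∈ norm ⁻¹' s from ha _ ((le_max_left _ _).trans hx))
    exact ⟨by simpa using this.2, this.1⟩
  have hφat {x} (hx : x ∈ Ω) : ContDiffAt ℝ 2 φ x :=
    (hφ.contDiffAt (hΩo.mem_nhds hx)).of_le (WithTop.coe_le_coe.2 (le_top : (2 : ℕ∞) ≤ ⊤))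
  have hwat {x} (hx : x ∈ Ω) : ContDiffAt ℝ 2 (fun y => φ y ^ 2) x := (hφat hx).pow 2
  set μ := √((E - lam - δ) / 2)
  have hμ : 0 < μ := Real.sqrt_pos.2 (by linarith)
  have hμsq : μ ^ 2 = (E - lam - δ) / 2 := Real.sq_sqrt (by linarith)
  have hlapw {x} (hx : R ≤ ‖x‖) : (2 * μ) ^ 2 * φ x ^ 2 ≤ lap (fun y => φ y ^ 2) x := by
    obtain ⟨hxΩ, hvx⟩ := hRΩ x hx
    refine le_trans ?_ (two_mul_mul_lap_le_lap_sq (hφat hxΩ))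
    have : lap φ x = (v x - lam) * φ x := by linarith [heq x hxΩ]
    rw [this, mul_pow, hμsq]
    nlinarith [sq_nonneg (φ x)]
  have hdecay : Tendsto (fun x => φ x ^ 2) (cocompact _) (nhds 0) :=
    tendsto_zero_of_subharmonic (fun x => sq_nonneg _) (fun x hx => hwat (hRΩ x hx).1)
      (fun x hx => le_trans (by positivity) (hlapw hx))
      (hφL2.mono_set fun x hx => (hRΩ x hx).1)
  obtain ⟨B, hB⟩ := ((isCompact_closedBall (0 : EuclideanSpace ℝ Λ) R).inter_left
    isClosed_closure).exists_bound_of_continuousOn (hφc.mono Set.inter_subset_left)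
  set C := (|B| + 1) * Real.exp (μ * √(1 + R ^ 2))
  have hC : 0 < C := by positivity
  have hinner {x} (hx : x ∈ Ω) (hxR : ‖x‖ ≤ R) :
      φ x ^ 2 - C ^ 2 * Real.exp (-(2 * μ) * bracket x) ≤ 0 := by
    have h₁ : |φ x| ≤ |B| + 1 :=
      (hB x ⟨subset_closure hx, by simpa using hxR⟩).trans (by linarith [le_abs_self B])
    have h₂ : bracket x ≤ √(1 + R ^ 2) := by unfold bracket; gcongr
    have h₃ : C ^ 2 * Real.exp (-(2 * μ) * bracket x)
        = (|B| + 1) ^ 2 * Real.exp (2 * μ * (√(1 + R ^ 2) - bracket x)) := by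
      rw [mul_pow, ← Real.exp_nat_mul, mul_assoc, ← Real.exp_add]
      congr 2; push_cast; ring
    have h₄ : 1 ≤ Real.exp (2 * μ * (√(1 + R ^ 2) - bracket x)) :=
      Real.one_le_exp (mul_nonneg (by positivity) (sub_nonneg.2 h₂))
    rw [h₃, ← sq_abs (φ x)]
    nlinarith [pow_le_pow_left₀ (abs_nonneg _) h₁ 2, sq_nonneg (|B| + 1)]
  have hgat (x : EuclideanSpace ℝ Λ) :
      ContDiffAt ℝ 2 (fun y => Real.exp (-(2 * μ) * bracket y)) x :=
    (contDiff_const.mul contDiff_bracket).exp.contDiffAt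
  have houter : ∀ x, R ≤ ‖x‖ → φ x ^ 2 - C ^ 2 * Real.exp (-(2 * μ) * bracket x) ≤ 0 := by
    have hat {x} (hx : R ≤ ‖x‖) : ContDiffAt ℝ 2
        (fun y => φ y ^ 2 - C ^ 2 * Real.exp (-(2 * μ) * bracket y)) x :=
      (hwat (hRΩ x hx).1).sub (contDiffAt_const.mul (hgat x))
    refine nonpos_of_lap_pos (fun x hx => hat hx) (fun x hx => hinner (hRΩ x hx.ge).1 hx.le)
      (fun η hη => ?_) fun x hx hpos => ?_
    · filter_upwards [hdecay.eventually (gt_mem_nhds hη)] with x hx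
      have : 0 < C ^ 2 * Real.exp (-(2 * μ) * bracket x) := by positivity
      linarith
    · rw [lap_sub_const_mul (hwat (hRΩ x hx.le).1) (hgat x)]
      have h₁ := mul_le_mul_of_nonneg_left
        (lap_exp_neg_mul_bracket_le (κ := 2 * μ) (by positivity) x) (sq_nonneg C)
      have h₂ := hlapw hx.le
      have h₃ := mul_pos (show 0 < (2 * μ) ^ 2 by positivity) hpos
      linarith
  refine ⟨C, hC, fun x hx => ?_⟩
  have hsq : φ x ^ 2 ≤ (C * Real.exp (-μ * bracket x)) ^ 2 := by
    have h : φ x ^ 2 - C ^ 2 * Real.exp (-(2 * μ) * bracket x) ≤ 0 :=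
      (le_total ‖x‖ R).elim (hinner hx) (houter x)
    rw [mul_pow, ← Real.exp_nat_mul]
    convert sub_nonpos.1 h using 3
    push_cast; ring
  refine (abs_le_of_sq_le_sq hsq (by positivity)).trans ?_
  have hrate : √((E - lam - ε) / 2) ≤ μ := Real.sqrt_le_sqrt (by linarith)
  have : √((E - lam - ε) / 2) * ‖x‖ ≤ μ * bracket x :=
    mul_le_mul hrate (norm_le_bracket x) (norm_nonneg x) hμ.le
  refine mul_le_mul_of_nonneg_left (Real.exp_le_exp.2 ?_) hC.le
  linarith
end
end

section
/- Let Λ be a finite domain in ℤ^d and Φ(x) = x²/2 + Ψ(x) with Ψ ∈ C^∞ compactly supported and |∂^α∇Ψ| ≤ C_α for all α. Let g and h be smooth compactly supported functions with disjoint lattice supports S_g = Γ and S_h = Γ' (Γ, Γ' ⊊ Λ, Γ ∩ Γ' = ∅), each satisfying |∂^α∇g| ≤ C_α and |∂^α∇h| ≤ C_α. Assume M⁻¹(Hess Φ(x))M ≥ δ₀ ∈ (0,1) for every diagonal matrix M = diag(ρ(i)) with weight ρ satisfying e^{−λ} ≤ ρ(i)/ρ(j) ≤ e^{λ} for nearest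 neighbors i ∼ j. Then |cov(g,h)| ≤ C e^{−κ d(S_g, S_h)}, where C, κ > 0 do not depend on Λ (but may depend on the sizes of the supports of g and h). -/
noncomputable section
open MeasureTheory Real Filter

/-- The ℓ¹ (lattice) distance between two sites of `ℤ^d`. -/
def latDist {d : ℕ} (i j : Fin d → ℤ) : ℕ := ∑ k, (i k - j k).natAbs

/-- The lattice distance from a site to a finite set of sites. -/
def latDistSet {d : ℕ} (i : Fin d → ℤ) (S : Finset (Fin d → ℤ)) : ℝ :=
  sInf ((fun j => (latDist i j : ℝ)) '' ↑S)

/-- The lattice distance between two finite sets of sites. -/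
def latDistSets {d : ℕ} (S T : Finset (Fin d → ℤ)) : ℝ :=
  sInf (Set.image2 (fun i j => (latDist i j : ℝ)) (↑S : Set (Fin d → ℤ)) (↑T : Set (Fin d → ℤ)))

set_option linter.unusedSectionVars false

namespace GibbsCovariance

open Function

variable {Λ : Type*} [Fintype Λ]

/-- The quadratic potential perturbed by `Ψ`. -/
abbrev potential (Ψ : EuclideanSpace ℝ Λ → ℝ) : EuclideanSpace ℝ Λ → ℝ :=
  fun y => ‖y‖ ^ 2 / 2 + Ψ y

lemma integrable_exp_neg_sq_norm {b : ℝ} (hb : 0 < b) :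
    Integrable (fun x : EuclideanSpace ℝ Λ => Real.exp (-b * ‖x‖ ^ 2)) := by
  have h := (GaussianFourier.integrable_cexp_neg_mul_sq_norm_add (V := EuclideanSpace ℝ Λ)
    (b := (b : ℂ)) (by simpa using hb) 0 0).norm
  refine h.congr (Eventually.of_forall fun x => ?_)
  simp only [zero_mul, add_zero, Complex.norm_exp]
  congr 1
  norm_cast

lemma temperate_potential {Ψ : EuclideanSpace ℝ Λ → ℝ} (hΨ : ContDiff ℝ (⊤ : ℕ∞) Ψ)
    (hc : HasCompactSupport Ψ) : (potential Ψ).HasTemperateGrowth := by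
  have h1 : Ψ.HasTemperateGrowth := hc.hasTemperateGrowth hΨ
  have h2 : (fun x : EuclideanSpace ℝ Λ => ‖x‖ ^ 2).HasTemperateGrowth :=
    hasTemperateGrowth_norm_sq _
  have h3 := (h2.mul (.const (2 : ℝ)⁻¹)).add h1
  simpa [potential, div_eq_mul_inv] using! h3

lemma exists_bound {Ψ : EuclideanSpace ℝ Λ → ℝ} (hΨ : ContDiff ℝ (⊤ : ℕ∞) Ψ)
    (hc : HasCompactSupport Ψ) : ∃ B, ∀ x, |Ψ x| ≤ B :=
  let ⟨B, hB⟩ := hΨ.continuous.bounded_above_of_compact_support hc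
  ⟨B, hB⟩

/-- Functions of at most exponential growth are integrable against `e^{-Φ}`. -/
lemma integrable_mul_exp_neg_potential {Ψ : EuclideanSpace ℝ Λ → ℝ}
    (hΨ : ContDiff ℝ (⊤ : ℕ∞) Ψ) (hc : HasCompactSupport Ψ) {F : EuclideanSpace ℝ Λ → ℝ}
    (hF : Continuous F) {A c : ℝ} (hb : ∀ x, |F x| ≤ A * Real.exp (c * ‖x‖)) :
    Integrable (fun x => F x * Real.exp (-potential Ψ x)) := by
  obtain ⟨B, hB⟩ := exists_bound hΨ hc
  have hΨ' := hΨ.continuous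
  refine ((integrable_exp_neg_sq_norm (Λ := Λ) (b := 1 / 4) (by norm_num)).const_mul
    (A * Real.exp (c ^ 2 + B))).mono' (by unfold potential; fun_prop)
    (Eventually.of_forall fun x => ?_)
  have hA : 0 ≤ A := by
    have := (abs_nonneg _).trans (hb 0)
    simpa using this
  rw [Real.norm_eq_abs, abs_mul, Real.abs_exp]
  calc |F x| * Real.exp (-potential Ψ x)
      ≤ A * Real.exp (c * ‖x‖) * Real.exp (-potential Ψ x) := by gcongr; exact hb x
    _ = A * Real.exp (c * ‖x‖ - potential Ψ x) := by
        rw [mul_assoc, ← Real.exp_add, sub_eq_add_neg]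
    _ ≤ A * Real.exp (c ^ 2 + B + -(1 / 4) * ‖x‖ ^ 2) := by
        gcongr
        have := (abs_le.1 (hB x)).1
        unfold potential
        nlinarith [sq_nonneg (c - ‖x‖ / 2)]
    _ = _ := by rw [Real.exp_add, mul_assoc]

lemma partition_pos {Ψ : EuclideanSpace ℝ Λ → ℝ} (hΨ : ContDiff ℝ (⊤ : ℕ∞) Ψ)
    (hc : HasCompactSupport Ψ) : 0 < ∫ x, Real.exp (-potential Ψ x) := by
  refine integral_exp_pos ?_
  simpa using integrable_mul_exp_neg_potential hΨ hc (F := fun _ => 1) continuous_const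
    (A := 1) (c := 0) (by simp)

lemma integral_gibbs {Ψ : EuclideanSpace ℝ Λ → ℝ} (hΨ : ContDiff ℝ (⊤ : ℕ∞) Ψ)
    (hc : HasCompactSupport Ψ) (F : EuclideanSpace ℝ Λ → ℝ) :
    ∫ x, F x ∂(gibbs (potential Ψ)) =
      (∫ x, Real.exp (-potential Ψ x))⁻¹ * ∫ x, F x * Real.exp (-potential Ψ x) := by
  have hΨ' := hΨ.continuous
  have hm : Measurable fun x => ENNReal.ofReal (Real.exp (-potential Ψ x)) := by
    unfold potential; fun_prop
  rw [gibbs, integral_smul_measure, integral_withDensity_eq_integral_toReal_smul hm (by simp)]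
  simp only [smul_eq_mul, ENNReal.toReal_inv, ENNReal.toReal_ofReal (Real.exp_pos _).le,
    ENNReal.toReal_ofReal (partition_pos hΨ hc).le]
  simp only [mul_comm]

lemma integrable_gibbs_of_exp_bound {Ψ : EuclideanSpace ℝ Λ → ℝ}
    (hΨ : ContDiff ℝ (⊤ : ℕ∞) Ψ) (hc : HasCompactSupport Ψ) {F : EuclideanSpace ℝ Λ → ℝ}
    (hF : Continuous F) {A c : ℝ} (hb : ∀ x, |F x| ≤ A * Real.exp (c * ‖x‖)) :
    Integrable F (gibbs (potential Ψ)) := by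
  have hΨ' := hΨ.continuous
  have hm : Measurable fun x => ENNReal.ofReal (Real.exp (-potential Ψ x)) := by
    unfold potential; fun_prop
  refine Integrable.smul_measure ?_ ?_
  · rw [integrable_withDensity_iff_integrable_smul' hm (by simp)]
    simpa [ENNReal.toReal_ofReal (Real.exp_pos _).le, mul_comm] using
      integrable_mul_exp_neg_potential hΨ hc hF hb
  · simpa using partition_pos hΨ hc

lemma isProbabilityMeasure_gibbs {Ψ : EuclideanSpace ℝ Λ → ℝ} (hΨ : ContDiff ℝ (⊤ : ℕ∞) Ψ)
    (hc : HasCompactSupport Ψ) : IsProbabilityMeasure (gibbs (potential Ψ)) := by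
  have hi : Integrable (fun x => Real.exp (-potential Ψ x)) := by
    simpa using integrable_mul_exp_neg_potential hΨ hc (F := fun _ => 1) continuous_const
      (A := 1) (c := 0) (by simp)
  refine ⟨?_⟩
  rw [gibbs, Measure.smul_apply, withDensity_apply _ MeasurableSet.univ, Measure.restrict_univ,
    ← ofReal_integral_eq_lintegral_ofReal hi (Eventually.of_forall fun _ => (Real.exp_pos _).le),
    smul_eq_mul]
  exact ENNReal.inv_mul_cancel (by simpa using partition_pos hΨ hc) ENNReal.ofReal_ne_top

lemma temperate_exp_bound {F : EuclideanSpace ℝ Λ → ℝ} (hF : F.HasTemperateGrowth) :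
    ∃ A c : ℝ, ∀ x, |F x| ≤ A * Real.exp (c * ‖x‖) := by
  obtain ⟨k, C, hC, h⟩ := hF.norm_iteratedFDeriv_le_uniform 0
  refine ⟨C, k, fun x => ?_⟩
  have := h 0 le_rfl x
  rw [norm_iteratedFDeriv_zero] at this
  refine this.trans ?_
  gcongr
  rw [Real.exp_nat_mul]
  gcongr
  rw [add_comm]
  exact Real.add_one_le_exp _

lemma integrable_temperate {Ψ : EuclideanSpace ℝ Λ → ℝ}
    (hΨ : ContDiff ℝ (⊤ : ℕ∞) Ψ) (hc : HasCompactSupport Ψ) {F : EuclideanSpace ℝ Λ → ℝ}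
    (hF : F.HasTemperateGrowth) : Integrable F (gibbs (potential Ψ)) :=
  let ⟨_, _, h⟩ := temperate_exp_bound hF
  integrable_gibbs_of_exp_bound hΨ hc hF.1.continuous h

lemma memLp_temperate {Ψ : EuclideanSpace ℝ Λ → ℝ}
    (hΨ : ContDiff ℝ (⊤ : ℕ∞) Ψ) (hc : HasCompactSupport Ψ) {F : EuclideanSpace ℝ Λ → ℝ}
    (hF : F.HasTemperateGrowth) : MemLp F 2 (gibbs (potential Ψ)) :=
  (memLp_two_iff_integrable_sq hF.1.continuous.aestronglyMeasurable).2
    (integrable_temperate hΨ hc (hF.pow 2))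

variable [DecidableEq Λ]

@[fun_prop]
lemma temperate_pd {u : EuclideanSpace ℝ Λ → ℝ} (hu : u.HasTemperateGrowth) (i : Λ) :
    (pd u i).HasTemperateGrowth := by
  have h : (fderiv ℝ u).HasTemperateGrowth := by
    refine ⟨hu.1.fderiv_right (by simp), fun n => ?_⟩
    obtain ⟨k, C, h⟩ := hu.2 (n + 1)
    refine ⟨k, C, fun x => ?_⟩
    rw [norm_iteratedFDeriv_fderiv]
    exact h x
  exact ((ContinuousLinearMap.apply ℝ ℝ
    (EuclideanSpace.single i (1 : ℝ))).hasTemperateGrowth).comp h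

lemma pd_add {u v : EuclideanSpace ℝ Λ → ℝ} (hu : u.HasTemperateGrowth)
    (hv : v.HasTemperateGrowth) (i : Λ) (x) :
    pd (fun y => u y + v y) i x = pd u i x + pd v i x := by
  have hu' := hu.1.differentiable (by simp) x
  have hv' := hv.1.differentiable (by simp) x
  simp [pd, fderiv_fun_add hu' hv']

lemma pd_sub {u v : EuclideanSpace ℝ Λ → ℝ} (hu : u.HasTemperateGrowth)
    (hv : v.HasTemperateGrowth) (i : Λ) (x) :
    pd (fun y => u y - v y) i x = pd u i x - pd v i x := by
  have hu' := hu.1.differentiable (by simp) x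
  have hv' := hv.1.differentiable (by simp) x
  simp [pd, fderiv_fun_sub hu' hv']

lemma pd_mul {u v : EuclideanSpace ℝ Λ → ℝ} (hu : u.HasTemperateGrowth)
    (hv : v.HasTemperateGrowth) (i : Λ) (x) :
    pd (fun y => u y * v y) i x = pd u i x * v x + u x * pd v i x := by
  have hu' := hu.1.differentiable (by simp) x
  have hv' := hv.1.differentiable (by simp) x
  simp [pd, fderiv_fun_mul hu' hv']
  ring

@[simp]
lemma pd_const (c : ℝ) (i : Λ) (x : EuclideanSpace ℝ Λ) : pd (fun _ => c) i x = 0 := by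
  simp [pd]

lemma pd_const_mul {u : EuclideanSpace ℝ Λ → ℝ} (hu : u.HasTemperateGrowth) (c : ℝ)
    (i : Λ) (x) : pd (fun y => c * u y) i x = c * pd u i x := by
  rw [pd_mul (by fun_prop) hu]; simp

lemma pd_sum {ι : Type*} (s : Finset ι) {u : ι → EuclideanSpace ℝ Λ → ℝ}
    (hu : ∀ j ∈ s, (u j).HasTemperateGrowth) (i : Λ) (x) :
    pd (fun y => ∑ j ∈ s, u j y) i x = ∑ j ∈ s, pd (u j) i x := by
  simp only [pd]
  rw [fderiv_fun_sum fun j hj => (hu j hj).1.differentiable (by simp) x]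
  simp

lemma pd_comm {u : EuclideanSpace ℝ Λ → ℝ} (hu : u.HasTemperateGrowth) (i j : Λ) :
    pd (pd u i) j = pd (pd u j) i := by
  ext x
  have hd : DifferentiableAt ℝ (fderiv ℝ u) x :=
    (hu.1.fderiv_right (m := 1) (by norm_cast)).differentiable (by simp) x
  have hs : IsSymmSndFDerivAt ℝ u x :=
    hu.1.contDiffAt.isSymmSndFDerivAt (by
      rw [minSmoothness_of_isRCLikeNormedField]
      exact WithTop.coe_le_coe.2 (le_top : (2 : ℕ∞) ≤ ⊤))
  have key (k l : Λ) : pd (pd u k) l x =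
      fderiv ℝ (fderiv ℝ u) x (EuclideanSpace.single l 1) (EuclideanSpace.single k 1) := by
    change fderiv ℝ (fun y => fderiv ℝ u y (EuclideanSpace.single k 1)) x _ = _
    rw [fderiv_clm_apply hd (by fun_prop)]
    simp
  rw [key, key, hs]

lemma pd_potential {Ψ : EuclideanSpace ℝ Λ → ℝ} (hΨ : ContDiff ℝ (⊤ : ℕ∞) Ψ) (i : Λ) (x) :
    pd (potential Ψ) i x = x i + pd Ψ i x := by
  have h1 : DifferentiableAt ℝ Ψ x := hΨ.differentiable (by simp) x
  have h2 : HasFDerivAt (fun y : EuclideanSpace ℝ Λ => ‖y‖ ^ 2) (2 • innerSL ℝ x) x :=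
    (hasStrictFDerivAt_norm_sq x).hasFDerivAt
  have h3 : HasFDerivAt (potential Ψ) ((2 : ℝ)⁻¹ • (2 • innerSL ℝ x) + fderiv ℝ Ψ x) x := by
    have h4 : potential Ψ = (fun y => (2 : ℝ)⁻¹ * ‖y‖ ^ 2) + Ψ := by
      ext y; simp [potential, div_eq_inv_mul]
    rw [h4]
    exact (h2.const_mul (2 : ℝ)⁻¹).add h1.hasFDerivAt
  rw [pd, h3.fderiv]
  simp [pd, EuclideanSpace.inner_single_right]

/-- The formal adjoint of the `i`-th partial derivative in `L²(e^{-Φ})`. -/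
def adj (Φ : EuclideanSpace ℝ Λ → ℝ) (i : Λ) (w : EuclideanSpace ℝ Λ → ℝ)
    (x : EuclideanSpace ℝ Λ) : ℝ :=
  pd Φ i x * w x - pd w i x

/-- The operator `-Δ + ∇Φ·∇`. -/
def gen (Φ : EuclideanSpace ℝ Λ → ℝ) (u : EuclideanSpace ℝ Λ → ℝ)
    (x : EuclideanSpace ℝ Λ) : ℝ :=
  ∑ i, adj Φ i (pd u i) x

@[fun_prop]
lemma temperate_adj {Φ : EuclideanSpace ℝ Λ → ℝ} (hΦ : Φ.HasTemperateGrowth) (i : Λ)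
    {w : EuclideanSpace ℝ Λ → ℝ} (hw : w.HasTemperateGrowth) : (adj Φ i w).HasTemperateGrowth := by
  have h1 := temperate_pd hΦ i
  have h2 := temperate_pd hw i
  exact (h1.mul hw).sub h2

@[fun_prop]
lemma temperate_gen {Φ : EuclideanSpace ℝ Λ → ℝ} (hΦ : Φ.HasTemperateGrowth)
    {u : EuclideanSpace ℝ Λ → ℝ} (hu : u.HasTemperateGrowth) : (gen Φ u).HasTemperateGrowth :=
  .sum fun i _ => temperate_adj hΦ i (temperate_pd hu i)

/-- Integration by parts against the Gibbs measure. -/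
lemma integral_pd_mul {Ψ : EuclideanSpace ℝ Λ → ℝ}
    (hΨ : ContDiff ℝ (⊤ : ℕ∞) Ψ) (hc : HasCompactSupport Ψ) {u w : EuclideanSpace ℝ Λ → ℝ}
    (hu : u.HasTemperateGrowth) (hw : w.HasTemperateGrowth) (i : Λ) :
    ∫ x, pd u i x * w x ∂(gibbs (potential Ψ)) =
      ∫ x, u x * adj (potential Ψ) i w x ∂(gibbs (potential Ψ)) := by
  have hΦ := temperate_potential hΨ hc
  have h_integrable {F : EuclideanSpace ℝ Λ → ℝ} (hF : F.HasTemperateGrowth) :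
      Integrable (fun x => F x * Real.exp (-potential Ψ x)) :=
    let ⟨_, _, h⟩ := temperate_exp_bound hF
    integrable_mul_exp_neg_potential hΨ hc hF.1.continuous h
  have hE (x) : fderiv ℝ (fun x => w x * Real.exp (-potential Ψ x)) x
      (EuclideanSpace.single i 1) =
        -(adj (potential Ψ) i w x * Real.exp (-potential Ψ x)) := by
    have h1 : DifferentiableAt ℝ (potential Ψ) x := hΦ.1.differentiable (by simp) x
    have h2 : DifferentiableAt ℝ w x := hw.1.differentiable (by simp) x
    rw [fderiv_fun_mul h2 (by fun_prop), fderiv_exp (by fun_prop), fderiv_fun_neg]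
    simp [adj, pd]
    ring
  have h := integral_mul_fderiv_eq_neg_fderiv_mul_of_integrable (μ := volume)
    (f := u) (g := fun x => w x * Real.exp (-potential Ψ x)) (v := EuclideanSpace.single i (1 : ℝ))
    ?_ ?_ ?_ ?_ ?_
  · rw [integral_gibbs hΨ hc, integral_gibbs hΨ hc]
    congr 1
    simp only [hE, mul_neg, integral_neg, neg_inj, ← mul_assoc] at h
    exact h.symm
  · simpa only [mul_assoc, Pi.mul_apply] using! h_integrable ((temperate_pd hu i).mul hw)
  · simp only [hE, mul_neg]
    refine Integrable.neg ?_
    simpa only [mul_assoc, Pi.mul_apply] using! h_integrable (hu.mul (temperate_adj hΦ i hw))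
  · simpa only [mul_assoc, Pi.mul_apply] using! h_integrable (hu.mul hw)
  · exact fun x _ => hu.1.differentiable (by simp) x
  · intro x _
    have h1 : DifferentiableAt ℝ (potential Ψ) x := hΦ.1.differentiable (by simp) x
    have h2 : DifferentiableAt ℝ w x := hw.1.differentiable (by simp) x
    fun_prop

section Polynomials

open MvPolynomial

/-- The Ornstein-Uhlenbeck operator `-Δ + x·∇` on polynomials. -/
def ouPoly (P : MvPolynomial Λ ℝ) : MvPolynomial Λ ℝ :=
  ∑ i, (X i * pderiv i P - pderiv i (pderiv i P))

lemma ouPoly_add (P Q : MvPolynomial Λ ℝ) : ouPoly (P + Q) = ouPoly P + ouPoly Q := by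
  simp only [ouPoly, map_add, ← Finset.sum_add_distrib]
  exact Finset.sum_congr rfl fun i _ => by ring

lemma ouPoly_monomial (m : Λ →₀ ℕ) (a : ℝ) : ouPoly (monomial m a) =
    (m.degree : ℝ) • monomial m a - ∑ i, pderiv i (pderiv i (monomial m a)) := by
  rw [ouPoly, Finset.sum_sub_distrib,
    (isHomogeneous_monomial (R := ℝ) a (rfl : m.degree = m.degree)).sum_X_mul_pderiv]
  simp [Nat.cast_smul_eq_nsmul]

/-- Modulo constants, `-Δ + x·∇ + s` is surjective on polynomials. -/
lemma exists_ouPoly_add_eq {s : ℝ} (hs : 0 ≤ s) (P : MvPolynomial Λ ℝ) :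
    ∃ (Q : MvPolynomial Λ ℝ) (c : ℝ), ouPoly Q + C s * Q + C c = P := by
  let S : AddSubmonoid (MvPolynomial Λ ℝ) :=
    { carrier := {P | ∃ (Q : MvPolynomial Λ ℝ) (c : ℝ), ouPoly Q + C s * Q + C c = P}
      zero_mem' := ⟨0, 0, by simp [ouPoly]⟩
      add_mem' := by
        rintro _ _ ⟨Q, c, rfl⟩ ⟨Q', c', rfl⟩
        exact ⟨Q + Q', c + c', by rw [ouPoly_add, map_add]; ring⟩ }
  have key : ∀ (n : ℕ) (m : Λ →₀ ℕ) (a : ℝ), m.degree = n → monomial m a ∈ S := by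
    intro n
    induction n using Nat.strong_induction_on with
    | _ n ih =>
      intro m a hm
      rcases Nat.eq_zero_or_pos n with rfl | hn
      · obtain rfl : m = 0 := (Finsupp.degree_eq_zero_iff m).1 hm
        exact ⟨0, a, by simp [ouPoly]⟩
      · have hpos : (0 : ℝ) < m.degree + s := by
          have : (0 : ℝ) < m.degree := by rw [hm]; exact_mod_cast hn
          linarith
        set b := a / (m.degree + s) with hb
        have hlow : ∑ i, pderiv i (pderiv i (monomial m b)) ∈ S := by
          refine S.sum_mem fun i _ => ?_
          rw [pderiv_monomial, pderiv_monomial]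
          by_cases h : m i = 0
          · simp only [h, Nat.cast_zero, mul_zero, zero_mul, monomial_zero]
            exact S.zero_mem
          · refine ih _ ?_ _ _ rfl
            have h1 : (m - Finsupp.single i 1).degree < n := by
              have h2 : m - Finsupp.single i 1 + Finsupp.single i 1 = m :=
                tsub_add_cancel_of_le (by simpa using Nat.one_le_iff_ne_zero.2 h)
              have h3 := congrArg Finsupp.degree h2
              rw [map_add, hm, Finsupp.degree_single] at h3
              omega
            refine lt_of_le_of_lt ?_ h1
            exact Finsupp.degree_mono tsub_le_self
        have htop : ouPoly (monomial m b) + C s * monomial m b ∈ S :=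
          ⟨monomial m b, 0, by simp⟩
        convert! S.add_mem htop hlow using 1
        rw [ouPoly_monomial, C_mul_monomial, smul_monomial, smul_eq_mul]
        rw [show a = m.degree * b + s * b by rw [hb]; field_simp, map_add]
        ring
  have hP : P ∈ S := by
    rw [P.as_sum]
    exact S.sum_mem fun m _ => key _ m _ rfl
  exact hP

/-- The function on Euclidean space defined by a polynomial. -/
def evalFun (P : MvPolynomial Λ ℝ) (x : EuclideanSpace ℝ Λ) : ℝ :=
  eval (fun i => x i) P

@[simp] lemma evalFun_C (c : ℝ) : evalFun (Λ := Λ) (C c) = fun _ => c := by ext; simp [evalFun]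

lemma evalFun_add (P Q : MvPolynomial Λ ℝ) :
    evalFun (P + Q) = fun x => evalFun P x + evalFun Q x := by ext; simp [evalFun]

lemma evalFun_mul (P Q : MvPolynomial Λ ℝ) :
    evalFun (P * Q) = fun x => evalFun P x * evalFun Q x := by ext; simp [evalFun]

@[simp] lemma evalFun_X (i : Λ) : evalFun (X i) = fun x => x i := by ext; simp [evalFun]

lemma temperate_coord (i : Λ) :
    (fun x : EuclideanSpace ℝ Λ => x i).HasTemperateGrowth :=
  (EuclideanSpace.proj i : EuclideanSpace ℝ Λ →L[ℝ] ℝ).hasTemperateGrowth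

lemma pd_coord (i j : Λ) (x : EuclideanSpace ℝ Λ) :
    pd (fun x : EuclideanSpace ℝ Λ => x j) i x = if i = j then 1 else 0 := by
  have h := (EuclideanSpace.proj j : EuclideanSpace ℝ Λ →L[ℝ] ℝ).fderiv (x := x)
  change fderiv ℝ (EuclideanSpace.proj j : EuclideanSpace ℝ Λ →L[ℝ] ℝ) x _ = _
  rw [h]
  simp [eq_comm]

lemma temperate_evalFun (P : MvPolynomial Λ ℝ) : (evalFun P).HasTemperateGrowth := by
  induction P using MvPolynomial.induction_on with
  | C a => simp
  | add p q hp hq => rw [evalFun_add]; exact hp.add hq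
  | mul_X p i hp => rw [evalFun_mul, evalFun_X]; exact hp.mul (temperate_coord i)

lemma pd_evalFun (P : MvPolynomial Λ ℝ) (i : Λ) : pd (evalFun P) i = evalFun (pderiv i P) := by
  induction P using MvPolynomial.induction_on with
  | C a => ext x; rw [evalFun_C, pd_const, pderiv_C]; simp [evalFun]
  | add p q hp hq =>
    ext x
    rw [evalFun_add, pd_add (temperate_evalFun p) (temperate_evalFun q), hp, hq, map_add,
      evalFun_add]
  | mul_X p j hp =>
    ext x
    rw [evalFun_mul, evalFun_X, pd_mul (temperate_evalFun p) (temperate_coord j), hp, pd_coord]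
    by_cases h : i = j
    · subst h; simp [evalFun, pderiv_X]; ring
    · simp [evalFun, pderiv_X, h, eq_comm, mul_comm]

lemma evalFun_ouPoly (P : MvPolynomial Λ ℝ) (x : EuclideanSpace ℝ Λ) :
    evalFun (ouPoly P) x =
      ∑ i, (x i * pd (evalFun P) i x - pd (pd (evalFun P) i) i x) := by
  simp only [pd_evalFun]
  simp [evalFun, ouPoly]

lemma gen_evalFun {Ψ : EuclideanSpace ℝ Λ → ℝ} (hΨ : ContDiff ℝ (⊤ : ℕ∞) Ψ)
    (P : MvPolynomial Λ ℝ) (x : EuclideanSpace ℝ Λ) :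
    gen (potential Ψ) (evalFun P) x =
      evalFun (ouPoly P) x + ∑ i, pd Ψ i x * pd (evalFun P) i x := by
  rw [evalFun_ouPoly, ← Finset.sum_add_distrib]
  refine Finset.sum_congr rfl fun i _ => ?_
  rw [adj, pd_potential hΨ]
  ring

end Polynomials

section Density

/-- In `L²(μ)`, a subspace of functions whose orthogonal complement is trivial is dense. -/
lemma exists_integral_sq_sub_le {α : Type*} [MeasurableSpace α] {μ : Measure α}
    (A : Submodule ℝ (α → ℝ)) (hA : ∀ u ∈ A, MemLp u 2 μ)
    (h : ∀ f, MemLp f 2 μ → (∀ u ∈ A, ∫ x, f x * u x ∂μ = 0) → ∫ x, f x ^ 2 ∂μ = 0)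
    {f : α → ℝ} (hf : MemLp f 2 μ) {ε : ℝ} (hε : 0 < ε) :
    ∃ u ∈ A, ∫ x, (u x - f x) ^ 2 ∂μ ≤ ε := by
  let T : A →ₗ[ℝ] Lp ℝ 2 μ :=
    { toFun := fun u => (hA u u.2).toLp
      map_add' := fun u v => MemLp.toLp_add (hA u u.2) (hA v v.2)
      map_smul' := fun c u => MemLp.toLp_const_smul c (hA u u.2) }
  have hsq (F : Lp ℝ 2 μ) : ‖F‖ ^ 2 = ∫ x, F x ^ 2 ∂μ := by
    rw [← real_inner_self_eq_norm_sq, L2.inner_def]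
    simp [sq]
  have htop : (LinearMap.range T).topologicalClosure = ⊤ := by
    rw [Submodule.topologicalClosure_eq_top_iff, Submodule.eq_bot_iff]
    intro F hF
    have h0 := h F (Lp.memLp F) fun u hu => by
      have h1 := (Submodule.mem_orthogonal _ _).1 hF (T ⟨u, hu⟩) ⟨_, rfl⟩
      rw [L2.inner_def] at h1
      rw [← h1]
      refine integral_congr_ae ?_
      filter_upwards [(hA u hu).coeFn_toLp] with x hx
      change _ = inner ℝ ((hA u hu).toLp u x) _
      rw [hx]
      simp
    rw [← hsq] at h0
    simpa using h0
  have hmem : hf.toLp ∈ closure (LinearMap.range T : Set (Lp ℝ 2 μ)) := by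
    rw [← Submodule.topologicalClosure_coe, htop]
    trivial
  obtain ⟨_, ⟨u, rfl⟩, hu⟩ := Metric.mem_closure_iff.1 hmem (√ε) (Real.sqrt_pos.2 hε)
  refine ⟨u, u.2, ?_⟩
  rw [dist_comm, dist_eq_norm] at hu
  have h2 : ‖T u - hf.toLp‖ ^ 2 ≤ ε := by
    rw [← Real.sq_sqrt hε.le]
    gcongr
  rw [hsq] at h2
  refine le_of_eq_of_le (integral_congr_ae ?_) h2
  filter_upwards [(hA u u.2).coeFn_toLp, hf.coeFn_toLp, Lp.coeFn_sub (T u) hf.toLp]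
    with x hx hx' hx''
  rw [hx'', Pi.sub_apply, hx']
  change _ = ((hA u u.2).toLp (u : α → ℝ) x - _) ^ 2
  rw [hx]

/-- An integrable function whose Fourier-Stieltjes transform vanishes is zero. -/
lemma ae_eq_zero_of_integral_cexp_eq_zero {E : Type*} [NormedAddCommGroup E]
    [InnerProductSpace ℝ E] [CompleteSpace E] [SecondCountableTopology E] [MeasurableSpace E]
    [BorelSpace E] {μ : Measure E} [SFinite μ] {f : E → ℝ} (hf : Integrable f μ)
    (h : ∀ t : E, ∫ x, (f x : ℂ) * Complex.exp (inner ℝ x t * Complex.I) ∂μ = 0) :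
    f =ᵐ[μ] 0 := by
  have hpos : AEMeasurable (fun x => ENNReal.ofReal (f x)) μ := hf.1.aemeasurable.ennreal_ofReal
  have hneg : AEMeasurable (fun x => ENNReal.ofReal (-f x)) μ :=
    hf.1.aemeasurable.neg.ennreal_ofReal
  have hposf : ∫⁻ x, ENNReal.ofReal (f x) ∂μ ≠ ⊤ := hf.lintegral_lt_top.ne
  have hnegf : ∫⁻ x, ENNReal.ofReal (-f x) ∂μ ≠ ⊤ := hf.neg.lintegral_lt_top.ne
  have := isFiniteMeasure_withDensity hposf
  have := isFiniteMeasure_withDensity hnegf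
  have hmeas (t : E) : AEStronglyMeasurable
      (fun x => Complex.exp (inner ℝ x t * Complex.I)) μ := by
    have : Continuous fun x : E => Complex.exp (inner ℝ x t * Complex.I) := by fun_prop
    exact this.aestronglyMeasurable
  have h_integrable {F : E → ℝ} (hF : Integrable F μ) (t : E) : Integrable
      (fun x => (F x : ℂ) * Complex.exp (inner ℝ x t * Complex.I)) μ := by
    refine hF.norm.mono' ((Complex.continuous_ofReal.comp_aestronglyMeasurable hF.1).mul (hmeas t)) (Eventually.of_forall fun x => ?_)
    rw [norm_mul, Complex.norm_exp_ofReal_mul_I]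
    simp
  have heq : μ.withDensity (fun x => ENNReal.ofReal (f x)) =
      μ.withDensity (fun x => ENNReal.ofReal (-f x)) := by
    refine Measure.ext_of_charFun (funext fun t => ?_)
    rw [charFun_apply, charFun_apply,
      integral_withDensity_eq_integral_toReal_smul₀ hpos (by simp),
      integral_withDensity_eq_integral_toReal_smul₀ hneg (by simp), ← sub_eq_zero]
    simp only [ENNReal.toReal_ofReal', Complex.real_smul]
    rw [← integral_sub (h_integrable hf.pos_part t) (h_integrable hf.neg_part t), ← h t]
    refine integral_congr_ae (Eventually.of_forall fun x => ?_)
    simp only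
    rw [← sub_mul, ← Complex.ofReal_sub]
    congr 2
    exact posPart_sub_negPart (f x)
  have := (withDensity_eq_iff hpos hneg hposf).1 heq
  filter_upwards [this] with x hx
  rcases le_total 0 (f x) with h0 | h0
  · rw [ENNReal.ofReal_of_nonpos (neg_nonpos.2 h0), ENNReal.ofReal_eq_zero] at hx
    exact le_antisymm hx h0
  · rw [ENNReal.ofReal_of_nonpos h0, eq_comm, ENNReal.ofReal_eq_zero] at hx
    exact le_antisymm h0 (by simpa using hx)

/-- Polynomials are total in `L²` of the Gibbs measure. -/
lemma ae_eq_zero_of_integral_mul_evalFun_eq_zero {Ψ : EuclideanSpace ℝ Λ → ℝ}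
    (hΨ : ContDiff ℝ (⊤ : ℕ∞) Ψ) (hc : HasCompactSupport Ψ) {f : EuclideanSpace ℝ Λ → ℝ}
    (hf : MemLp f 2 (gibbs (potential Ψ)))
    (h : ∀ P, ∫ x, f x * evalFun P x ∂(gibbs (potential Ψ)) = 0) :
    f =ᵐ[gibbs (potential Ψ)] 0 := by
  have := isProbabilityMeasure_gibbs hΨ hc
  refine ae_eq_zero_of_integral_cexp_eq_zero (hf.integrable (by norm_num)) fun t => ?_
  have hexp : MemLp (fun x => Real.exp |inner ℝ x t|) 2 (gibbs (potential Ψ)) := by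
    have hcont : Continuous fun x : EuclideanSpace ℝ Λ => Real.exp |inner ℝ x t| := by fun_prop
    refine (memLp_two_iff_integrable_sq hcont.aestronglyMeasurable).2
      (integrable_gibbs_of_exp_bound hΨ hc (hcont.pow 2) (A := 1) (c := 2 * ‖t‖) fun x => ?_)
    rw [abs_of_nonneg (by positivity), ← Real.exp_nat_mul, one_mul]
    refine Real.exp_le_exp.2 ?_
    have := abs_real_inner_le_norm x t
    push_cast
    linarith
  have hsum := hasSum_integral_of_dominated_convergence (μ := gibbs (potential Ψ))
    (F := fun (k : ℕ) x => (f x : ℂ) * ((inner ℝ x t * Complex.I) ^ k / k.factorial))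
    (f := fun x => (f x : ℂ) * Complex.exp (inner ℝ x t * Complex.I))
    (fun k x => |f x| * (|inner ℝ x t| ^ k / k.factorial)) ?_ ?_ ?_ ?_ ?_
  · refine hsum.unique ?_
    convert! hasSum_zero using 2 with k
    have hk := h ((∑ i, MvPolynomial.C (t i) * MvPolynomial.X i) ^ k)
    have hk' (x : EuclideanSpace ℝ Λ) :
        evalFun ((∑ i, MvPolynomial.C (t i) * MvPolynomial.X i) ^ k) x = inner ℝ x t ^ k := by
      simp [evalFun, PiLp.inner_apply]
    simp only [hk'] at hk
    calc ∫ x, (f x : ℂ) * ((inner ℝ x t * Complex.I) ^ k / k.factorial) ∂(gibbs (potential Ψ))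
        = ∫ x, (Complex.I ^ k / k.factorial) * ((f x * inner ℝ x t ^ k : ℝ) : ℂ)
            ∂(gibbs (potential Ψ)) := by
          refine integral_congr_ae (Eventually.of_forall fun x => ?_)
          push_cast
          ring
      _ = 0 := by rw [integral_const_mul, integral_complex_ofReal, hk]; simp
  · intro k
    have : Continuous fun x : EuclideanSpace ℝ Λ =>
        ((inner ℝ x t * Complex.I : ℂ) ^ k / k.factorial) := by fun_prop
    exact (Complex.continuous_ofReal.comp_aestronglyMeasurable hf.1).mul this.aestronglyMeasurable
  · refine fun k => Eventually.of_forall fun x => le_of_eq ?_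
    simp
  · exact Eventually.of_forall fun x => (Real.summable_pow_div_factorial _).mul_left _
  · have heq : (fun x => ∑' k : ℕ, |f x| * (|inner ℝ x t| ^ k / k.factorial)) =
        fun x => |f x| * Real.exp |inner ℝ x t| := by
      ext x
      rw [tsum_mul_left, Real.exp_eq_exp_ℝ, NormedSpace.exp_eq_tsum_div]
    rw [heq]
    exact hf.abs.integrable_mul hexp
  · refine Eventually.of_forall fun x => HasSum.mul_left _ ?_
    rw [Complex.exp_eq_exp_ℂ]
    exact NormedSpace.expSeries_div_hasSum_exp _

end Density

section Generator

lemma abs_integral_mul_le {α : Type*} [MeasurableSpace α] {μ : Measure α} {F G : α → ℝ}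
    (hF : MemLp F 2 μ) (hG : MemLp G 2 μ) {θ : ℝ} (hθ : 0 < θ) :
    |∫ x, F x * G x ∂μ| ≤ θ / 2 * ∫ x, F x ^ 2 ∂μ + θ⁻¹ / 2 * ∫ x, G x ^ 2 ∂μ := by
  have h1 := hF.integrable_sq
  have h2 := hG.integrable_sq
  rw [← integral_const_mul, ← integral_const_mul,
    ← integral_add (h1.const_mul _) (h2.const_mul _)]
  refine (abs_integral_le_integral_abs).trans (integral_mono (hF.integrable_mul hG).abs
    ((h1.const_mul _).add (h2.const_mul _)) fun x => ?_)
  have h3 : θ / 2 * F x ^ 2 + θ⁻¹ / 2 * G x ^ 2 - F x * G x = (θ * F x - G x) ^ 2 / (2 * θ) := by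
    field_simp; ring
  have h4 : θ / 2 * F x ^ 2 + θ⁻¹ / 2 * G x ^ 2 + F x * G x = (θ * F x + G x) ^ 2 / (2 * θ) := by
    field_simp; ring
  have h5 : 0 ≤ (θ * F x - G x) ^ 2 / (2 * θ) := by positivity
  have h6 : 0 ≤ (θ * F x + G x) ^ 2 / (2 * θ) := by positivity
  simp only
  exact abs_le.2 ⟨by linarith, by linarith⟩

lemma le_of_forall_le_add_mul {a b c : ℝ} (h : ∀ η, 0 < η → η ≤ 1 → a ≤ b + η * c) : a ≤ b := by
  have h1 : Tendsto (fun η : ℝ => b + η * c) (nhdsWithin 0 (Set.Ioi 0)) (nhds (b + 0 * c)) :=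
    ((continuous_const.add (continuous_id.mul continuous_const)).tendsto 0).mono_left
      nhdsWithin_le_nhds
  rw [zero_mul, add_zero] at h1
  refine ge_of_tendsto h1 ?_
  filter_upwards [Ioc_mem_nhdsGT (one_pos : (0 : ℝ) < 1)] with η hη using h η hη.1 hη.2

lemma sum_sq_pd_le (u : EuclideanSpace ℝ Λ → ℝ) (x : EuclideanSpace ℝ Λ) :
    ∑ i, pd u i x ^ 2 ≤ ‖fderiv ℝ u x‖ ^ 2 := by
  set v : EuclideanSpace ℝ Λ := ∑ i, pd u i x • EuclideanSpace.single i (1 : ℝ) with hv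
  have hvi (i : Λ) : v i = pd u i x := by
    simp [hv, Finset.sum_apply, Pi.single_apply]
  have h1 : fderiv ℝ u x v = ∑ i, pd u i x ^ 2 := by
    rw [hv, map_sum]
    exact Finset.sum_congr rfl fun i _ => by rw [map_smul, smul_eq_mul, sq]; rfl
  have h2 : ‖v‖ ^ 2 = ∑ i, pd u i x ^ 2 := by
    rw [EuclideanSpace.norm_sq_eq]
    simp [hvi]
  have h3 : ‖v‖ ^ 2 ≤ ‖fderiv ℝ u x‖ * ‖v‖ := by
    rw [h2, ← h1]
    exact (le_abs_self _).trans ((fderiv ℝ u x).le_opNorm v)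
  rw [← h2]
  have h4 : ‖v‖ ≤ ‖fderiv ℝ u x‖ := by
    rcases (norm_nonneg v).eq_or_lt with h | h
    · rw [← h]; positivity
    · rw [sq] at h3; exact le_of_mul_le_mul_right h3 h
  gcongr

lemma gen_add {Φ u v : EuclideanSpace ℝ Λ → ℝ} (hu : u.HasTemperateGrowth)
    (hv : v.HasTemperateGrowth) (x) :
    gen Φ (fun y => u y + v y) x = gen Φ u x + gen Φ v x := by
  rw [gen, gen, gen, ← Finset.sum_add_distrib]
  refine Finset.sum_congr rfl fun i _ => ?_
  have h : pd (fun y => u y + v y) i = fun y => pd u i y + pd v i y := funext (pd_add hu hv i)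
  rw [adj, h, pd_add (temperate_pd hu i) (temperate_pd hv i), adj, adj]
  ring

lemma gen_const_mul {Φ u : EuclideanSpace ℝ Λ → ℝ} (hu : u.HasTemperateGrowth) (c : ℝ) (x) :
    gen Φ (fun y => c * u y) x = c * gen Φ u x := by
  rw [gen, gen, Finset.mul_sum]
  refine Finset.sum_congr rfl fun i _ => ?_
  have h : pd (fun y => c * u y) i = fun y => c * pd u i y := funext (pd_const_mul hu c i)
  rw [adj, h, pd_const_mul (temperate_pd hu i), adj]
  ring

lemma gen_zero {Φ : EuclideanSpace ℝ Λ → ℝ} (x) : gen Φ (fun _ => 0) x = 0 := by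
  have h (i : Λ) : pd (fun _ : EuclideanSpace ℝ Λ => (0 : ℝ)) i = fun _ => 0 :=
    funext fun x => pd_const 0 i x
  simp [gen, adj, h]

/-- The functions `(-Δ + ∇Φ·∇ + s) u + c` with `c ∈ V`. -/
def rangeGen (Φ : EuclideanSpace ℝ Λ → ℝ) (s : ℝ) (V : Submodule ℝ ℝ) :
    Submodule ℝ (EuclideanSpace ℝ Λ → ℝ) where
  carrier := {F | ∃ u : EuclideanSpace ℝ Λ → ℝ, u.HasTemperateGrowth ∧
    ∃ c ∈ V, F = fun x => gen Φ u x + s * u x + c}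
  zero_mem' := ⟨fun _ => 0, by fun_prop, 0, V.zero_mem, by ext; simp [gen_zero]⟩
  add_mem' := by
    rintro _ _ ⟨u, hu, c, hc, rfl⟩ ⟨v, hv, c', hc', rfl⟩
    refine ⟨fun y => u y + v y, by fun_prop, c + c', V.add_mem hc hc', ?_⟩
    ext x
    simp only [Pi.add_apply, gen_add hu hv]
    ring
  smul_mem' := by
    rintro a _ ⟨u, hu, c, hc, rfl⟩
    refine ⟨fun y => a * u y, by fun_prop, a * c, V.smul_mem a hc, ?_⟩
    ext x
    simp only [Pi.smul_apply, smul_eq_mul, gen_const_mul hu]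
    ring

lemma memLp_rangeGen {Ψ : EuclideanSpace ℝ Λ → ℝ} (hΨ : ContDiff ℝ (⊤ : ℕ∞) Ψ)
    (hc : HasCompactSupport Ψ)
    {s : ℝ} {V : Submodule ℝ ℝ} :
    ∀ F ∈ rangeGen (potential Ψ) s V, MemLp F 2 (gibbs (potential Ψ)) := by
  have hΦ := temperate_potential hΨ hc
  rintro _ ⟨u, hu, c, -, rfl⟩
  have := temperate_gen hΦ hu
  exact memLp_temperate hΨ hc (by fun_prop)

lemma integral_mul_sum_adj {Ψ : EuclideanSpace ℝ Λ → ℝ} (hΨ : ContDiff ℝ (⊤ : ℕ∞) Ψ)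
    (hc : HasCompactSupport Ψ)
    {u : EuclideanSpace ℝ Λ → ℝ} (hu : u.HasTemperateGrowth)
    {w : Λ → EuclideanSpace ℝ Λ → ℝ} (hw : ∀ i, (w i).HasTemperateGrowth) :
    ∫ x, u x * ∑ i, adj (potential Ψ) i (w i) x ∂(gibbs (potential Ψ)) =
      ∑ i, ∫ x, pd u i x * w i x ∂(gibbs (potential Ψ)) := by
  have hΦ := temperate_potential hΨ hc
  simp only [Finset.mul_sum]
  have hi (i : Λ) : Integrable (fun x => u x * adj (potential Ψ) i (w i) x)
      (gibbs (potential Ψ)) := integrable_temperate hΨ hc (hu.mul (temperate_adj hΦ i (hw i)))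
  rw [integral_finsetSum _ fun i _ => hi i]
  exact Finset.sum_congr rfl fun i _ => (integral_pd_mul hΨ hc hu (hw i) i).symm

/-- The Dirichlet form of the generator. -/
lemma integral_mul_gen {Ψ : EuclideanSpace ℝ Λ → ℝ} (hΨ : ContDiff ℝ (⊤ : ℕ∞) Ψ)
    (hc : HasCompactSupport Ψ)
    {u w : EuclideanSpace ℝ Λ → ℝ} (hu : u.HasTemperateGrowth)
    (hw : w.HasTemperateGrowth) :
    ∫ x, w x * gen (potential Ψ) u x ∂(gibbs (potential Ψ)) =
      ∑ i, ∫ x, pd w i x * pd u i x ∂(gibbs (potential Ψ)) :=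
  integral_mul_sum_adj hΨ hc hw fun i => temperate_pd hu i

lemma integral_gen {Ψ : EuclideanSpace ℝ Λ → ℝ} (hΨ : ContDiff ℝ (⊤ : ℕ∞) Ψ)
    (hc : HasCompactSupport Ψ)
    {u : EuclideanSpace ℝ Λ → ℝ} (hu : u.HasTemperateGrowth) :
    ∫ x, gen (potential Ψ) u x ∂(gibbs (potential Ψ)) = 0 := by
  have h := integral_mul_gen hΨ hc hu (w := fun _ => 1) (by fun_prop)
  simpa using h

lemma two_mul_sum_integral_sq_pd_le {Ψ : EuclideanSpace ℝ Λ → ℝ} (hΨ : ContDiff ℝ (⊤ : ℕ∞) Ψ)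
    (hc : HasCompactSupport Ψ)
    {u : EuclideanSpace ℝ Λ → ℝ} (hu : u.HasTemperateGrowth)
    {f : EuclideanSpace ℝ Λ → ℝ} (hf : MemLp f 2 (gibbs (potential Ψ)))
    (h : ∫ x, f x * gen (potential Ψ) u x ∂(gibbs (potential Ψ)) = 0) (s : ℝ) :
    2 * s * ∑ i, ∫ x, pd u i x ^ 2 ∂(gibbs (potential Ψ)) +
      s ^ 2 * ∫ x, (u x - f x) ^ 2 ∂(gibbs (potential Ψ)) ≤
      ∫ x, (gen (potential Ψ) u x + s * u x - s * f x) ^ 2 ∂(gibbs (potential Ψ)) := by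
  have hg : MemLp (gen (potential Ψ) u) 2 (gibbs (potential Ψ)) :=
    memLp_temperate hΨ hc (temperate_gen (temperate_potential hΨ hc) hu)
  have hu' := memLp_temperate hΨ hc hu
  have h1 : Integrable (fun x => u x * gen (potential Ψ) u x) (gibbs (potential Ψ)) :=
    hu'.integrable_mul hg
  have h2 : Integrable (fun x => f x * gen (potential Ψ) u x) (gibbs (potential Ψ)) :=
    hf.integrable_mul hg
  have h3 : Integrable (fun x => (u x - f x) ^ 2) (gibbs (potential Ψ)) :=
    (hu'.sub hf).integrable_sq
  have h4 := hg.integrable_sq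
  have h5 : ∫ x, (gen (potential Ψ) u x + s * u x - s * f x) ^ 2 ∂(gibbs (potential Ψ)) =
      ∫ x, gen (potential Ψ) u x ^ 2 ∂(gibbs (potential Ψ)) +
      2 * s * ∫ x, u x * gen (potential Ψ) u x ∂(gibbs (potential Ψ)) -
      2 * s * ∫ x, f x * gen (potential Ψ) u x ∂(gibbs (potential Ψ)) +
      s ^ 2 * ∫ x, (u x - f x) ^ 2 ∂(gibbs (potential Ψ)) := by
    have h41 := h4.add (h1.const_mul (2 * s))
    have h42 := h41.sub (h2.const_mul (2 * s))
    simp only [← integral_const_mul]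
    rw [← integral_add h4 (h1.const_mul _)]
    erw [← integral_sub h41 (h2.const_mul _), ← integral_add h42 (h3.const_mul _)]
    exact integral_congr_ae (Eventually.of_forall fun x => by
      simp only [Pi.add_apply, Pi.sub_apply]; ring)
  rw [h5, h, integral_mul_gen hΨ hc hu hu]
  have h6 : 0 ≤ ∫ x, gen (potential Ψ) u x ^ 2 ∂(gibbs (potential Ψ)) :=
    integral_nonneg fun x => sq_nonneg _
  simp only [← sq]
  linarith

/-- The range of `-Δ + ∇Φ·∇ + s` is dense for some `s > 0`. -/
lemma exists_resolvent_dense {Ψ : EuclideanSpace ℝ Λ → ℝ} (hΨ : ContDiff ℝ (⊤ : ℕ∞) Ψ)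
    (hc : HasCompactSupport Ψ) :
    ∃ s : ℝ, 0 < s ∧ ∀ f, MemLp f 2 (gibbs (potential Ψ)) →
    (∀ F ∈ rangeGen (potential Ψ) s ⊥, ∫ x, f x * F x ∂(gibbs (potential Ψ)) = 0) →
    ∫ x, f x ^ 2 ∂(gibbs (potential Ψ)) = 0 := by
  have hΦ := temperate_potential hΨ hc
  have hΨT : Ψ.HasTemperateGrowth := hc.hasTemperateGrowth hΨ
  obtain ⟨B, hB⟩ : ∃ B, ∀ x, ‖fderiv ℝ Ψ x‖ ≤ B :=
    (hΨ.continuous_fderiv (by simp)).bounded_above_of_compact_support (hc.fderiv ℝ)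
  refine ⟨5 * B ^ 2 + 1, by positivity, fun f hf hF => ?_⟩
  set s : ℝ := 5 * B ^ 2 + 1 with hs
  have hspos : 0 < s := by positivity
  have hpoly (ε : ℝ) (hε : 0 < ε) :
      ∃ P, ∫ x, (evalFun P x - f x) ^ 2 ∂(gibbs (potential Ψ)) ≤ ε := by
    let A : Submodule ℝ (EuclideanSpace ℝ Λ → ℝ) :=
      { carrier := Set.range evalFun
        zero_mem' := ⟨0, by ext; simp [evalFun]⟩
        add_mem' := by
          rintro _ _ ⟨P, rfl⟩ ⟨Q, rfl⟩
          exact ⟨P + Q, by rw [evalFun_add]; rfl⟩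
        smul_mem' := by
          rintro a _ ⟨P, rfl⟩
          exact ⟨MvPolynomial.C a * P, by rw [evalFun_mul, evalFun_C]; rfl⟩ }
    obtain ⟨_, ⟨P, rfl⟩, hP⟩ := exists_integral_sq_sub_le A
      (by rintro _ ⟨P, rfl⟩; exact memLp_temperate hΨ hc (temperate_evalFun P))
      (fun f hf h => by
        have h0 := ae_eq_zero_of_integral_mul_evalFun_eq_zero hΨ hc hf fun P => h _ ⟨P, rfl⟩
        refine (integral_congr_ae ?_).trans (integral_zero _ ℝ)
        filter_upwards [h0] with x hx
        simp [hx]) hf hε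
    exact ⟨P, hP⟩
  have hle (ε : ℝ) (hε : 0 < ε) : ∫ x, f x ^ 2 ∂(gibbs (potential Ψ)) ≤ 0 + ε := by
    obtain ⟨P, hP⟩ := hpoly (ε / 5) (by positivity)
    obtain ⟨Q, hQ⟩ : ∃ Q, ouPoly Q + MvPolynomial.C s * Q = P := by
      obtain ⟨Q, c, rfl⟩ := exists_ouPoly_add_eq hspos.le P
      refine ⟨Q + MvPolynomial.C (c / s), ?_⟩
      have h0 : ouPoly (MvPolynomial.C (c / s) : MvPolynomial Λ ℝ) = 0 := by simp [ouPoly]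
      rw [ouPoly_add, h0, mul_add, ← MvPolynomial.C_mul, mul_div_cancel₀ _ hspos.ne']
      ring
    set u := evalFun Q with hu'
    have hu : u.HasTemperateGrowth := temperate_evalFun Q
    set k : EuclideanSpace ℝ Λ → ℝ := fun x => ∑ i, pd Ψ i x * pd u i x with hk
    have hkT : k.HasTemperateGrowth := .sum fun i _ => (temperate_pd hΨT i).mul (temperate_pd hu i)
    have hφT := temperate_evalFun P
    have hgen (x) : gen (potential Ψ) u x + s * u x = evalFun P x + k x := by
      rw [hu', gen_evalFun hΨ, ← hQ]
      simp only [evalFun_add, evalFun_mul, evalFun_C]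
      ring
    have hφL := memLp_temperate hΨ hc hφT
    have hkL := memLp_temperate hΨ hc hkT
    have h1 : ∫ x, f x * (evalFun P x + k x) ∂(gibbs (potential Ψ)) = 0 := by
      refine hF _ ⟨u, hu, 0, rfl, ?_⟩
      ext x
      rw [hgen, add_zero]
    have h2 : 2 * s * ∑ i, ∫ x, pd u i x ^ 2 ∂(gibbs (potential Ψ)) ≤
        ∫ x, (evalFun P x + k x) ^ 2 ∂(gibbs (potential Ψ)) := by
      have := two_mul_sum_integral_sq_pd_le hΨ hc hu (f := fun _ => 0)
        (memLp_temperate hΨ hc (by fun_prop)) (by simp) s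
      simp only [mul_zero, sub_zero, hgen] at this
      have h0 : 0 ≤ s ^ 2 * ∫ x, u x ^ 2 ∂(gibbs (potential Ψ)) := by positivity
      linarith
    have h3 : ∫ x, k x ^ 2 ∂(gibbs (potential Ψ)) ≤
        B ^ 2 * ∑ i, ∫ x, pd u i x ^ 2 ∂(gibbs (potential Ψ)) := by
      have hi (i : Λ) : Integrable (fun x => pd u i x ^ 2) (gibbs (potential Ψ)) :=
        integrable_temperate hΨ hc ((temperate_pd hu i).pow 2)
      rw [← integral_finsetSum _ fun i _ => hi i, ← integral_const_mul]
      refine integral_mono hkL.integrable_sq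
        ((integrable_finsetSum _ fun i _ => hi i).const_mul _) fun x => ?_
      refine (Finset.sum_mul_sq_le_sq_mul_sq _ _ _).trans ?_
      have : ∑ i, pd Ψ i x ^ 2 ≤ B ^ 2 :=
        (sum_sq_pd_le Ψ x).trans (by gcongr; exact hB x)
      dsimp only
      gcongr
    have hfφ : Integrable (fun x => f x * evalFun P x) (gibbs (potential Ψ)) :=
      hf.integrable_mul hφL
    have hfk : Integrable (fun x => f x * k x) (gibbs (potential Ψ)) := hf.integrable_mul hkL
    have h4 : ∫ x, (evalFun P x + k x) ^ 2 ∂(gibbs (potential Ψ)) ≤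
        2 * ∫ x, evalFun P x ^ 2 ∂(gibbs (potential Ψ)) +
        2 * ∫ x, k x ^ 2 ∂(gibbs (potential Ψ)) := by
      rw [← integral_const_mul, ← integral_const_mul, ← integral_add
        (hφL.integrable_sq.const_mul _) (hkL.integrable_sq.const_mul _)]
      refine integral_mono (hφL.add hkL).integrable_sq
        ((hφL.integrable_sq.const_mul _).add (hkL.integrable_sq.const_mul _)) fun x => ?_
      have := sq_nonneg (evalFun P x - k x)
      simp only
      linarith
    have h5 : ∫ x, (evalFun P x - f x) ^ 2 ∂(gibbs (potential Ψ)) =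
        ∫ x, evalFun P x ^ 2 ∂(gibbs (potential Ψ)) -
        2 * ∫ x, f x * evalFun P x ∂(gibbs (potential Ψ)) +
        ∫ x, f x ^ 2 ∂(gibbs (potential Ψ)) := by
      have hi := hφL.integrable_sq.sub (hfφ.const_mul 2)
      rw [← integral_const_mul, ← integral_sub hφL.integrable_sq (hfφ.const_mul _)]
      erw [← integral_add hi hf.integrable_sq]
      exact integral_congr_ae (Eventually.of_forall fun x => by
      simp only [Pi.sub_apply]; ring)
    have h6 : ∫ x, f x * evalFun P x ∂(gibbs (potential Ψ)) +
        ∫ x, f x * k x ∂(gibbs (potential Ψ)) = 0 := by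
      rw [← integral_add hfφ hfk, ← h1]
      simp only [mul_add]
    have h7 := (abs_le.1 (abs_integral_mul_le hf hkL one_pos)).1
    have h8 : ∫ x, k x ^ 2 ∂(gibbs (potential Ψ)) ≤
        1 / 4 * ∫ x, evalFun P x ^ 2 ∂(gibbs (potential Ψ)) := by
      have hS : 0 ≤ ∑ i, ∫ x, pd u i x ^ 2 ∂(gibbs (potential Ψ)) :=
        Finset.sum_nonneg fun i _ => integral_nonneg fun x => sq_nonneg _
      have : 2 * s * ∑ i, ∫ x, pd u i x ^ 2 ∂(gibbs (potential Ψ)) =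
        10 * (B ^ 2 * ∑ i, ∫ x, pd u i x ^ 2 ∂(gibbs (potential Ψ))) +
          2 * ∑ i, ∫ x, pd u i x ^ 2 ∂(gibbs (potential Ψ)) := by rw [hs]; ring
      linarith
    have h9 : ∫ x, f x ^ 2 ∂(gibbs (potential Ψ)) ≤
        2 * ∫ x, (evalFun P x - f x) ^ 2 ∂(gibbs (potential Ψ)) +
        2 * ∫ x, evalFun P x ^ 2 ∂(gibbs (potential Ψ)) := by
      have hi : Integrable (fun x => (evalFun P x - f x) ^ 2) (gibbs (potential Ψ)) :=
        (hφL.sub hf).integrable_sq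
      rw [← integral_const_mul, ← integral_const_mul, ← integral_add
        (hi.const_mul _) (hφL.integrable_sq.const_mul _)]
      refine integral_mono hf.integrable_sq
        ((hi.const_mul _).add (hφL.integrable_sq.const_mul _)) fun x => ?_
      have := sq_nonneg (2 * evalFun P x - f x)
      simp only
      linarith
    norm_num at h7
    linarith
  exact le_antisymm (le_of_forall_pos_le_add hle) (integral_nonneg fun x => sq_nonneg _)

/-- A function orthogonal to the range of the generator is weakly divergence free. -/
lemma integral_mul_sum_adj_eq_zero {Ψ : EuclideanSpace ℝ Λ → ℝ} (hΨ : ContDiff ℝ (⊤ : ℕ∞) Ψ)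
    (hc : HasCompactSupport Ψ)
    {f : EuclideanSpace ℝ Λ → ℝ}
    (hf : MemLp f 2 (gibbs (potential Ψ)))
    (h : ∀ u : EuclideanSpace ℝ Λ → ℝ, u.HasTemperateGrowth →
      ∫ x, f x * gen (potential Ψ) u x ∂(gibbs (potential Ψ)) = 0)
    {w : Λ → EuclideanSpace ℝ Λ → ℝ} (hw : ∀ i, (w i).HasTemperateGrowth) :
    ∫ x, f x * ∑ i, adj (potential Ψ) i (w i) x ∂(gibbs (potential Ψ)) = 0 := by
  have hΦ := temperate_potential hΨ hc
  obtain ⟨s, hs, hdense⟩ := exists_resolvent_dense hΨ hc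
  set D : EuclideanSpace ℝ Λ → ℝ := fun x => ∑ i, adj (potential Ψ) i (w i) x with hD
  have hDT : D.HasTemperateGrowth := .sum fun i _ => temperate_adj hΦ i (hw i)
  have hDL := memLp_temperate hΨ hc hDT
  set K := ∫ x, D x ^ 2 ∂(gibbs (potential Ψ)) with hK
  set W := ∑ i, ∫ x, w i x ^ 2 ∂(gibbs (potential Ψ)) with hW
  refine abs_eq_zero.1 (le_antisymm ?_ (abs_nonneg _))
  refine le_of_forall_le_add_mul (c := s⁻¹ ^ 2 / 2 + K / 2 + s⁻¹ / 4 + W / 2) fun η hη _ => ?_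
  obtain ⟨_, ⟨u, hu, c, rfl, rfl⟩, hu2⟩ := exists_integral_sq_sub_le (rangeGen (potential Ψ) s ⊥)
    (memLp_rangeGen hΨ hc) hdense (hf.const_mul s) (pow_pos hη 2)
  simp only [add_zero] at hu2
  have hres := (two_mul_sum_integral_sq_pd_le hΨ hc hu hf (h u hu) s).trans hu2
  have huL := memLp_temperate hΨ hc hu
  have hS : 0 ≤ ∑ i, ∫ x, pd u i x ^ 2 ∂(gibbs (potential Ψ)) :=
    Finset.sum_nonneg fun i _ => integral_nonneg fun x => sq_nonneg _
  have hT : 0 ≤ ∫ x, (u x - f x) ^ 2 ∂(gibbs (potential Ψ)) :=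
    integral_nonneg fun x => sq_nonneg _
  have h1 : ∫ x, (u x - f x) ^ 2 ∂(gibbs (potential Ψ)) ≤ s⁻¹ ^ 2 * η ^ 2 := by
    rw [inv_pow, ← div_eq_inv_mul, le_div_iff₀ (by positivity)]
    nlinarith [mul_nonneg hs.le hS]
  have h2 : ∑ i, ∫ x, pd u i x ^ 2 ∂(gibbs (potential Ψ)) ≤ s⁻¹ / 2 * η ^ 2 := by
    rw [show s⁻¹ / 2 * η ^ 2 = η ^ 2 / (2 * s) by field_simp, le_div_iff₀ (by positivity)]
    nlinarith [mul_nonneg (sq_nonneg s) hT]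
  have h3 : ∫ x, f x * D x ∂(gibbs (potential Ψ)) =
      ∑ i, ∫ x, pd u i x * w i x ∂(gibbs (potential Ψ)) -
        ∫ x, (u x - f x) * D x ∂(gibbs (potential Ψ)) := by
    rw [← integral_mul_sum_adj hΨ hc hu hw]
    have i1 : Integrable (fun x => u x * D x) (gibbs (potential Ψ)) := huL.integrable_mul hDL
    have i2 : Integrable (fun x => (u x - f x) * D x) (gibbs (potential Ψ)) :=
      (huL.sub hf).integrable_mul hDL
    rw [← integral_sub i1 i2]
    exact integral_congr_ae (Eventually.of_forall fun x => by simp only; ring)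
  have h4 : |∫ x, (u x - f x) * D x ∂(gibbs (potential Ψ))| ≤
      η⁻¹ / 2 * ∫ x, (u x - f x) ^ 2 ∂(gibbs (potential Ψ)) + η / 2 * K := by
    simpa using abs_integral_mul_le (huL.sub hf) hDL (inv_pos.2 hη)
  have h5 : |∑ i, ∫ x, pd u i x * w i x ∂(gibbs (potential Ψ))| ≤
      η⁻¹ / 2 * ∑ i, ∫ x, pd u i x ^ 2 ∂(gibbs (potential Ψ)) + η / 2 * W := by
    rw [hW, Finset.mul_sum, Finset.mul_sum, ← Finset.sum_add_distrib]
    refine (Finset.abs_sum_le_sum_abs _ _).trans (Finset.sum_le_sum fun i _ => ?_)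
    simpa using abs_integral_mul_le (memLp_temperate hΨ hc (temperate_pd hu i))
      (memLp_temperate hΨ hc (hw i)) (inv_pos.2 hη)
  have h6 : η⁻¹ / 2 * ∫ x, (u x - f x) ^ 2 ∂(gibbs (potential Ψ)) ≤ η * (s⁻¹ ^ 2 / 2) := by
    calc _ ≤ η⁻¹ / 2 * (s⁻¹ ^ 2 * η ^ 2) := by gcongr
      _ = _ := by field_simp
  have h7 : η⁻¹ / 2 * ∑ i, ∫ x, pd u i x ^ 2 ∂(gibbs (potential Ψ)) ≤ η * (s⁻¹ / 4) := by
    calc _ ≤ η⁻¹ / 2 * (s⁻¹ / 2 * η ^ 2) := by gcongr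
      _ = _ := by field_simp; norm_num
  rw [h3]
  refine (abs_sub _ _).trans ?_
  linarith

/-- The kernel of the generator consists of constants. -/
lemma integral_sq_eq_zero_of_integral_mul_gen {Ψ : EuclideanSpace ℝ Λ → ℝ} (hΨ : ContDiff ℝ (⊤ : ℕ∞) Ψ)
    (hc : HasCompactSupport Ψ)
    {f : EuclideanSpace ℝ Λ → ℝ}
    (hf : MemLp f 2 (gibbs (potential Ψ)))
    (h : ∀ u : EuclideanSpace ℝ Λ → ℝ, u.HasTemperateGrowth →
      ∫ x, f x * gen (potential Ψ) u x ∂(gibbs (potential Ψ)) = 0)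
    (h0 : ∫ x, f x ∂(gibbs (potential Ψ)) = 0) :
    ∫ x, f x ^ 2 ∂(gibbs (potential Ψ)) = 0 := by
  have := isProbabilityMeasure_gibbs hΨ hc
  have hΨT : Ψ.HasTemperateGrowth := hc.hasTemperateGrowth hΨ
  set E : EuclideanSpace ℝ Λ → ℝ := fun x => Real.exp (Ψ x) with hE
  have hET : E.HasTemperateGrowth := by
    have h1 : HasCompactSupport fun x => Real.exp (Ψ x) - 1 :=
      hc.comp_left (g := fun t => Real.exp t - 1) (by simp)
    have h2 : (fun x => Real.exp (Ψ x) - 1).HasTemperateGrowth :=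
      h1.hasTemperateGrowth (by fun_prop)
    have h3 := h2.add (.const (1 : ℝ))
    simpa [hE, Pi.add_def] using h3
  have hpdE (i : Λ) (x) : pd E i x = E x * pd Ψ i x := by
    have := hΨ.differentiable (by simp) x
    simp [hE, pd, fderiv_exp this]
  obtain ⟨B, hB⟩ := exists_bound hΨ hc
  have hEL (F : EuclideanSpace ℝ Λ → ℝ) (hF : MemLp F 2 (gibbs (potential Ψ))) :
      MemLp (fun x => F x * E x) 2 (gibbs (potential Ψ)) := by
    refine (hF.const_mul (Real.exp B)).of_le (hF.1.mul hET.1.continuous.aestronglyMeasurable)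
      (Eventually.of_forall fun x => ?_)
    have h1 : E x ≤ Real.exp B := Real.exp_le_exp.2 ((le_abs_self _).trans (hB x))
    have h2 : 0 < E x := Real.exp_pos _
    simp only [norm_mul, Real.norm_eq_abs, abs_of_pos h2, Real.abs_exp]
    rw [mul_comm]
    gcongr
  have hQ (Q : MvPolynomial Λ ℝ) {F : EuclideanSpace ℝ Λ → ℝ}
      (hF : MemLp F 2 (gibbs (potential Ψ)))
      (hFu : ∀ u : EuclideanSpace ℝ Λ → ℝ, u.HasTemperateGrowth →
        ∫ x, F x * gen (potential Ψ) u x ∂(gibbs (potential Ψ)) = 0) :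
      ∫ x, F x * E x * evalFun (ouPoly Q) x ∂(gibbs (potential Ψ)) = 0 := by
    have hq := temperate_evalFun Q
    rw [← integral_mul_sum_adj_eq_zero hΨ hc hF hFu
      (w := fun i x => E x * pd (evalFun Q) i x) fun i => hET.mul (temperate_pd hq i)]
    refine integral_congr_ae (Eventually.of_forall fun x => ?_)
    simp only
    rw [evalFun_ouPoly, mul_assoc, Finset.mul_sum]
    congr 1
    refine Finset.sum_congr rfl fun i _ => ?_
    rw [adj, pd_potential hΨ, pd_mul hET (temperate_pd hq i), hpdE]
    ring
  have hEi : Integrable E (gibbs (potential Ψ)) := integrable_temperate hΨ hc hET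
  have hEpos : 0 < ∫ x, E x ∂(gibbs (potential Ψ)) := integral_exp_pos hEi
  set c := (∫ x, f x * E x ∂(gibbs (potential Ψ))) / ∫ x, E x ∂(gibbs (potential Ψ)) with hcdef
  have hfc : MemLp (fun x => f x - c) 2 (gibbs (potential Ψ)) := hf.sub (memLp_const c)
  have hfcu (u : EuclideanSpace ℝ Λ → ℝ) (hu : u.HasTemperateGrowth) :
      ∫ x, (f x - c) * gen (potential Ψ) u x ∂(gibbs (potential Ψ)) = 0 := by
    have hg := temperate_gen (temperate_potential hΨ hc) hu
    have i1 : Integrable (fun x => f x * gen (potential Ψ) u x) (gibbs (potential Ψ)) :=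
      hf.integrable_mul (memLp_temperate hΨ hc hg)
    simp only [sub_mul]
    rw [integral_sub i1 ((integrable_temperate hΨ hc hg).const_mul c), h u hu,
      integral_const_mul, integral_gen hΨ hc hu]
    simp
  have hfE : ∫ x, (f x - c) * E x ∂(gibbs (potential Ψ)) = 0 := by
    have i1 : Integrable (fun x => f x * E x) (gibbs (potential Ψ)) :=
      hf.integrable_mul (memLp_temperate hΨ hc hET)
    simp only [sub_mul]
    rw [integral_sub i1 (hEi.const_mul c), integral_const_mul, hcdef, div_mul_cancel₀ _ hEpos.ne',
      sub_self]
  have hzero := ae_eq_zero_of_integral_mul_evalFun_eq_zero hΨ hc (hEL _ hfc) fun P => by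
    obtain ⟨Q, a, rfl⟩ := exists_ouPoly_add_eq le_rfl P
    have i1 : Integrable (fun x => (f x - c) * E x * evalFun (ouPoly Q) x) (gibbs (potential Ψ)) :=
      (hEL _ hfc).integrable_mul (memLp_temperate hΨ hc (temperate_evalFun _))
    have i2 : Integrable (fun x => (f x - c) * E x) (gibbs (potential Ψ)) :=
      (hEL _ hfc).integrable (by norm_num)
    simp only [map_zero, zero_mul, add_zero, evalFun_add, evalFun_C, mul_add]
    rw [integral_add i1 (i2.mul_const a), hQ Q hfc hfcu, integral_mul_const, hfE]
    simp
  have hfae : f =ᵐ[gibbs (potential Ψ)] fun _ => c := by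
    filter_upwards [hzero] with x hx
    have h2 : E x ≠ 0 := (Real.exp_pos _).ne'
    simpa [h2, sub_eq_zero] using hx
  have hc0 : c = 0 := by
    rw [integral_congr_ae hfae] at h0
    simpa using h0
  refine (integral_congr_ae ?_).trans (integral_zero _ ℝ)
  filter_upwards [hfae] with x hx
  simp [hx, hc0]

/-- Approximate solvability of `(-Δ + ∇Φ·∇) u = g - c`. -/
lemma exists_gen_approx {Ψ : EuclideanSpace ℝ Λ → ℝ} (hΨ : ContDiff ℝ (⊤ : ℕ∞) Ψ)
    (hc : HasCompactSupport Ψ)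
    {g : EuclideanSpace ℝ Λ → ℝ} (hg : g.HasTemperateGrowth)
    {ε : ℝ} (hε : 0 < ε) : ∃ (u : EuclideanSpace ℝ Λ → ℝ) (c : ℝ), u.HasTemperateGrowth ∧
      ∫ x, (gen (potential Ψ) u x + c - g x) ^ 2 ∂(gibbs (potential Ψ)) ≤ ε := by
  obtain ⟨_, ⟨u, hu, c, -, rfl⟩, h⟩ := exists_integral_sq_sub_le (rangeGen (potential Ψ) 0 ⊤)
    (memLp_rangeGen hΨ hc) (fun f hf h => integral_sq_eq_zero_of_integral_mul_gen hΨ hc hf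
      (fun u hu => h _ ⟨u, hu, 0, trivial, by simp⟩)
      (by simpa using h (fun _ => 1) ⟨fun _ => 0, by fun_prop, 1, trivial, by ext; simp [gen_zero]⟩))
    (memLp_temperate hΨ hc hg) hε
  exact ⟨u, c, hu, by simpa using h⟩

end Generator

section WeightedEstimate

lemma pd_adj {Φ w : EuclideanSpace ℝ Λ → ℝ} (hΦ : Φ.HasTemperateGrowth)
    (hw : w.HasTemperateGrowth) (i j : Λ) (x) :
    pd (adj Φ i w) j x = adj Φ i (pd w j) x + hess Φ x j i * w x := by
  have h1 := temperate_pd hΦ i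
  have h2 := temperate_pd hw i
  have h : adj Φ i w = fun y => pd Φ i y * w y - pd w i y := rfl
  rw [h, pd_sub (by fun_prop) h2, pd_mul h1 hw, pd_comm hw i j, adj, hess]
  ring

/-- The commutator of a partial derivative with the generator is the Hessian. -/
lemma pd_gen {Φ u : EuclideanSpace ℝ Λ → ℝ} (hΦ : Φ.HasTemperateGrowth)
    (hu : u.HasTemperateGrowth) (j : Λ) (x) :
    pd (gen Φ u) j x = gen Φ (pd u j) x + ∑ i, hess Φ x j i * pd u i x := by
  have h : gen Φ u = fun y => ∑ i, adj Φ i (pd u i) y := rfl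
  rw [h, pd_sum _ fun i _ => temperate_adj hΦ i (temperate_pd hu i), gen,
    ← Finset.sum_add_distrib]
  refine Finset.sum_congr rfl fun i _ => ?_
  rw [pd_adj hΦ (temperate_pd hu i), pd_comm hu i j]

lemma exists_hess_diag_le {Ψ : EuclideanSpace ℝ Λ → ℝ} (hΨ : ContDiff ℝ (⊤ : ℕ∞) Ψ)
    (hc : HasCompactSupport Ψ) :
    ∃ K, 0 ≤ K ∧ ∀ x i, hess (potential Ψ) x i i ≤ K := by
  have hΨT : Ψ.HasTemperateGrowth := hc.hasTemperateGrowth hΨ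
  have h (i : Λ) : ∃ B, ∀ x, ‖pd (pd Ψ i) i x‖ ≤ B :=
    (temperate_pd (temperate_pd hΨT i) i).1.continuous.bounded_above_of_compact_support
      ((hc.fderiv_apply ℝ _).fderiv_apply ℝ _)
  choose B hB using h
  have hB0 (i : Λ) : 0 ≤ B i := (norm_nonneg _).trans (hB i 0)
  refine ⟨1 + ∑ i, B i, by linarith [Finset.sum_nonneg fun i (_ : i ∈ Finset.univ) => hB0 i],
    fun x i => ?_⟩
  have h1 : pd (potential Ψ) i = fun x => x i + pd Ψ i x := funext (pd_potential hΨ i)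
  have h2 : pd (fun x : EuclideanSpace ℝ Λ => x i) i x = 1 := by simp [pd_coord]
  rw [hess, h1, pd_add (temperate_coord i) (temperate_pd hΨT i), h2]
  have h3 := (le_abs_self _).trans (hB i x)
  have h4 := Finset.single_le_sum (f := B) (fun i _ => hB0 i) (Finset.mem_univ i)
  linarith

lemma integral_sq_adj_le {Ψ : EuclideanSpace ℝ Λ → ℝ} (hΨ : ContDiff ℝ (⊤ : ℕ∞) Ψ)
    (hc : HasCompactSupport Ψ)
    {K : ℝ} (hK : ∀ x i, hess (potential Ψ) x i i ≤ K)
    {v : EuclideanSpace ℝ Λ → ℝ} (hv : v.HasTemperateGrowth) (i : Λ) :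
    ∫ x, adj (potential Ψ) i v x ^ 2 ∂(gibbs (potential Ψ)) ≤
      ∫ x, pd v i x ^ 2 ∂(gibbs (potential Ψ)) + K * ∫ x, v x ^ 2 ∂(gibbs (potential Ψ)) := by
  have hΦ := temperate_potential hΨ hc
  have h1 := temperate_adj hΦ i hv
  have h2 := temperate_pd hv i
  have h3 := temperate_adj hΦ i h2
  have h4 : (fun x => hess (potential Ψ) x i i).HasTemperateGrowth :=
    temperate_pd (temperate_pd hΦ i) i
  have i1 : Integrable (fun x => v x * adj (potential Ψ) i (pd v i) x) (gibbs (potential Ψ)) :=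
    integrable_temperate hΨ hc (by fun_prop)
  have i2 : Integrable (fun x => hess (potential Ψ) x i i * v x ^ 2) (gibbs (potential Ψ)) :=
    integrable_temperate hΨ hc (h4.mul (hv.pow 2))
  have i3 : Integrable (fun x => v x ^ 2) (gibbs (potential Ψ)) :=
    integrable_temperate hΨ hc (hv.pow 2)
  have e1 : ∫ x, adj (potential Ψ) i v x ^ 2 ∂(gibbs (potential Ψ)) =
      ∫ x, v x * adj (potential Ψ) i (pd v i) x ∂(gibbs (potential Ψ)) +
      ∫ x, hess (potential Ψ) x i i * v x ^ 2 ∂(gibbs (potential Ψ)) := by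
    simp only [sq (adj _ _ _ _)]
    rw [← integral_pd_mul hΨ hc h1 hv i, ← integral_add i1 i2]
    refine integral_congr_ae (Eventually.of_forall fun x => ?_)
    simp only
    rw [pd_adj hΦ hv]
    ring
  rw [e1, ← integral_pd_mul hΨ hc hv h2 i]
  simp only [← sq]
  gcongr
  rw [← integral_const_mul]
  refine integral_mono i2 (i3.const_mul K) fun x => ?_
  have := hK x i
  dsimp only
  gcongr

/-- Weighted Bochner inequality. -/
lemma weighted_bochner {Ψ : EuclideanSpace ℝ Λ → ℝ} (hΨ : ContDiff ℝ (⊤ : ℕ∞) Ψ)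
    (hc : HasCompactSupport Ψ)
    {δ : ℝ} {r : Λ → ℝ} (hr : ∀ i, 0 < r i)
    (hess_ge : ∀ (x) (a : Λ → ℝ), δ * ∑ i, a i ^ 2 ≤
      ∑ i, ∑ j, r i * hess (potential Ψ) x i j * (r j)⁻¹ * a i * a j)
    {u : EuclideanSpace ℝ Λ → ℝ} (hu : u.HasTemperateGrowth) :
    ∑ i, r i ^ 2 * ∑ j, ∫ x, pd (pd u i) j x ^ 2 ∂(gibbs (potential Ψ)) +
      δ * ∑ i, r i ^ 2 * ∫ x, pd u i x ^ 2 ∂(gibbs (potential Ψ)) ≤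
      ∑ i, r i ^ 2 * ∫ x, pd (gen (potential Ψ) u) i x * pd u i x ∂(gibbs (potential Ψ)) := by
  have hΦ := temperate_potential hΨ hc
  have hess_temperate (i j : Λ) : (fun x => hess (potential Ψ) x i j).HasTemperateGrowth :=
    temperate_pd (temperate_pd hΦ j) i
  have hp (i : Λ) := temperate_pd hu i
  have hHT (i : Λ) :
      (fun x => (∑ j, hess (potential Ψ) x i j * pd u j x) * pd u i x).HasTemperateGrowth :=
    .mul (.sum fun j _ => (hess_temperate i j).mul (hp j)) (hp i)
  have hH (i : Λ) := integrable_temperate hΨ hc (hHT i)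
  have hsq (i : Λ) : Integrable (fun x => pd u i x ^ 2) (gibbs (potential Ψ)) :=
    integrable_temperate hΨ hc ((hp i).pow 2)
  have h1 (i : Λ) : ∫ x, pd (gen (potential Ψ) u) i x * pd u i x ∂(gibbs (potential Ψ)) =
      ∑ j, ∫ x, pd (pd u i) j x ^ 2 ∂(gibbs (potential Ψ)) +
      ∫ x, (∑ j, hess (potential Ψ) x i j * pd u j x) * pd u i x ∂(gibbs (potential Ψ)) := by
    have i1 : Integrable (fun x => pd u i x * gen (potential Ψ) (pd u i) x)
        (gibbs (potential Ψ)) := integrable_temperate hΨ hc ((hp i).mul (temperate_gen hΦ (hp i)))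
    simp only [sq]
    rw [← integral_mul_gen hΨ hc (hp i) (hp i), ← integral_add i1 (hH i)]
    refine integral_congr_ae (Eventually.of_forall fun x => ?_)
    simp only
    rw [pd_gen hΦ hu]
    ring
  simp only [h1, mul_add, Finset.sum_add_distrib]
  gcongr
  simp only [← integral_const_mul]
  rw [← integral_finsetSum _ fun i _ => (hsq i).const_mul _,
    ← integral_finsetSum _ fun i _ => (hH i).const_mul _, ← integral_const_mul]
  refine integral_mono ((integrable_finsetSum _ fun i _ => (hsq i).const_mul _).const_mul _)
    (integrable_finsetSum _ fun i _ => (hH i).const_mul _) fun x => ?_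
  have h := hess_ge x fun i => r i * pd u i x
  simp only [mul_pow] at h
  refine h.trans_eq ?_
  refine Finset.sum_congr rfl fun i _ => ?_
  rw [Finset.sum_mul, Finset.mul_sum]
  refine Finset.sum_congr rfl fun j _ => ?_
  have := (hr j).ne'
  field_simp

/-- Weighted covariance estimate. -/
lemma abs_cov_le {Ψ : EuclideanSpace ℝ Λ → ℝ} (hΨ : ContDiff ℝ (⊤ : ℕ∞) Ψ)
    (hc : HasCompactSupport Ψ)
    {δ : ℝ} (hδ : 0 < δ) {r : Λ → ℝ} (hr : ∀ i, 0 < r i)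
    (hess_ge_one : ∀ (x) (a : Λ → ℝ), δ * ∑ i, a i ^ 2 ≤
      ∑ i, ∑ j, hess (potential Ψ) x i j * a i * a j)
    (hess_ge : ∀ (x) (a : Λ → ℝ), δ * ∑ i, a i ^ 2 ≤
      ∑ i, ∑ j, r i * hess (potential Ψ) x i j * (r j)⁻¹ * a i * a j)
    {g h : EuclideanSpace ℝ Λ → ℝ} (hg : g.HasTemperateGrowth) (hh : h.HasTemperateGrowth)
    {θ : ℝ} (hθ : 0 < θ) :
    |(∫ x, g x * h x ∂(gibbs (potential Ψ))) -
        (∫ x, g x ∂(gibbs (potential Ψ))) * ∫ x, h x ∂(gibbs (potential Ψ))| ≤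
      θ / 2 * (δ⁻¹ ^ 2 * ∑ i, r i ^ 2 * ∫ x, pd g i x ^ 2 ∂(gibbs (potential Ψ))) +
      θ⁻¹ / 2 * ∑ i, (r i ^ 2)⁻¹ * ∫ x, pd h i x ^ 2 ∂(gibbs (potential Ψ)) := by
  have := isProbabilityMeasure_gibbs hΨ hc
  have hΦ := temperate_potential hΨ hc
  obtain ⟨K, hK0, hK⟩ := exists_hess_diag_le hΨ hc
  set m := ∫ x, h x ∂(gibbs (potential Ψ)) with hm
  set V := ∫ x, (h x - m) ^ 2 ∂(gibbs (potential Ψ)) with hV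
  set G := ∑ i, r i ^ 2 * ∫ x, pd g i x ^ 2 ∂(gibbs (potential Ψ)) with hG
  set H := ∑ i, (r i ^ 2)⁻¹ * ∫ x, pd h i x ^ 2 ∂(gibbs (potential Ψ)) with hH
  set S := ∑ i, r i ^ 2 with hS
  set N := (1 + K * δ⁻¹) * (2 * ∫ x, g x ^ 2 ∂(gibbs (potential Ψ)) + 2) with hN
  refine le_of_forall_le_add_mul
    (c := θ / 2 * (δ⁻¹ * (S * (1 + N))) + (1 + V) / 2) fun η hη hη1 => ?_
  obtain ⟨u, c, hu, he2⟩ := exists_gen_approx hΨ hc hg (pow_pos hη 2)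
  have hp (i : Λ) := temperate_pd hu i
  have hgen := temperate_gen hΦ hu
  set e : EuclideanSpace ℝ Λ → ℝ := fun x => gen (potential Ψ) u x + c - g x with he
  have heT : e.HasTemperateGrowth := by fun_prop
  have heL := memLp_temperate hΨ hc heT
  have hgL := memLp_temperate hΨ hc hg
  set X := ∑ i, r i ^ 2 * ∫ x, pd u i x ^ 2 ∂(gibbs (potential Ψ)) with hX
  have hgen_sq : ∫ x, gen (potential Ψ) u x ^ 2 ∂(gibbs (potential Ψ)) ≤
      2 * ∫ x, g x ^ 2 ∂(gibbs (potential Ψ)) + 2 := by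
    have i0 := integrable_temperate hΨ hc hgen
    have i1 : Integrable (fun x => gen (potential Ψ) u x ^ 2) (gibbs (potential Ψ)) :=
      integrable_temperate hΨ hc (hgen.pow 2)
    have i2 : Integrable (fun x => gen (potential Ψ) u x ^ 2 + 2 * c * gen (potential Ψ) u x)
        (gibbs (potential Ψ)) := i1.add (i0.const_mul _)
    have h1 : ∫ x, (gen (potential Ψ) u x ^ 2 + 2 * c * gen (potential Ψ) u x + c ^ 2)
        ∂(gibbs (potential Ψ)) =
        ∫ x, gen (potential Ψ) u x ^ 2 ∂(gibbs (potential Ψ)) + c ^ 2 := by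
      rw [integral_add i2 (integrable_const _), integral_add i1 (i0.const_mul _),
        integral_const_mul, integral_gen hΨ hc hu]
      simp
    have h2 : ∫ x, (gen (potential Ψ) u x ^ 2 + 2 * c * gen (potential Ψ) u x + c ^ 2)
        ∂(gibbs (potential Ψ)) ≤
        ∫ x, (2 * g x ^ 2 + 2 * e x ^ 2) ∂(gibbs (potential Ψ)) := by
      refine integral_mono (i2.add (integrable_const _))
        ((hgL.integrable_sq.const_mul _).add (heL.integrable_sq.const_mul _)) fun x => ?_
      have h3 := sq_nonneg (e x - g x)
      have h4 : gen (potential Ψ) u x = e x + g x - c := by simp only [he]; ring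
      simp only [h4]
      linarith
    rw [integral_add (hgL.integrable_sq.const_mul _) (heL.integrable_sq.const_mul _),
      integral_const_mul, integral_const_mul] at h2
    nlinarith [sq_nonneg c]
  have hadj (i : Λ) :
      ∫ x, adj (potential Ψ) i (pd u i) x ^ 2 ∂(gibbs (potential Ψ)) ≤ N := by
    have hb := weighted_bochner hΨ hc (r := fun _ => 1) (fun _ => one_pos)
      (by simpa using hess_ge_one) hu
    simp only [one_pow, one_mul] at hb
    rw [← integral_mul_gen hΨ hc hu hgen] at hb
    simp only [← sq] at hb
    have h0 (v : EuclideanSpace ℝ Λ → ℝ) : 0 ≤ ∫ x, v x ^ 2 ∂(gibbs (potential Ψ)) :=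
      integral_nonneg fun x => sq_nonneg _
    have h1 := integral_sq_adj_le hΨ hc hK (hp i) i
    have h2 : ∫ x, pd (pd u i) i x ^ 2 ∂(gibbs (potential Ψ)) ≤
        ∑ i, ∑ j, ∫ x, pd (pd u i) j x ^ 2 ∂(gibbs (potential Ψ)) :=
      (Finset.single_le_sum (f := fun j => ∫ x, pd (pd u i) j x ^ 2 ∂(gibbs (potential Ψ)))
        (fun j _ => h0 _) (Finset.mem_univ i)).trans
      (Finset.single_le_sum
        (f := fun i => ∑ j, ∫ x, pd (pd u i) j x ^ 2 ∂(gibbs (potential Ψ)))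
        (fun i _ => Finset.sum_nonneg fun j _ => h0 _) (Finset.mem_univ i))
    have h3 : ∫ x, pd u i x ^ 2 ∂(gibbs (potential Ψ)) ≤
        ∑ i, ∫ x, pd u i x ^ 2 ∂(gibbs (potential Ψ)) :=
      Finset.single_le_sum (f := fun i => ∫ x, pd u i x ^ 2 ∂(gibbs (potential Ψ)))
        (fun j _ => h0 _) (Finset.mem_univ i)
    have h4 : 0 ≤ δ * ∑ i, ∫ x, pd u i x ^ 2 ∂(gibbs (potential Ψ)) :=
      mul_nonneg hδ.le ((h0 _).trans h3)
    have h5 : ∫ x, pd u i x ^ 2 ∂(gibbs (potential Ψ)) ≤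
        δ⁻¹ * (2 * ∫ x, g x ^ 2 ∂(gibbs (potential Ψ)) + 2) := by
      rw [← div_eq_inv_mul, le_div_iff₀ hδ]
      have := mul_le_mul_of_nonneg_left h3 hδ.le
      have := h0 (pd (pd u i) i)
      linarith
    have h6 := mul_le_mul_of_nonneg_left h5 hK0
    rw [hN]
    linarith
  have hXle : X ≤ δ⁻¹ ^ 2 * G + η * (δ⁻¹ * (S * (1 + N))) := by
    have hb := weighted_bochner hΨ hc hr hess_ge hu
    have h1 : 0 ≤ ∑ i, r i ^ 2 * ∑ j, ∫ x, pd (pd u i) j x ^ 2 ∂(gibbs (potential Ψ)) :=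
      Finset.sum_nonneg fun i _ => mul_nonneg (sq_nonneg _)
        (Finset.sum_nonneg fun j _ => integral_nonneg fun x => sq_nonneg _)
    have h2 (i : Λ) : ∫ x, pd (gen (potential Ψ) u) i x * pd u i x ∂(gibbs (potential Ψ)) ≤
        δ⁻¹ / 2 * ∫ x, pd g i x ^ 2 ∂(gibbs (potential Ψ)) +
        δ / 2 * ∫ x, pd u i x ^ 2 ∂(gibbs (potential Ψ)) + η / 2 * (1 + N) := by
      have hgi := temperate_pd hg i
      have hei := temperate_pd heT i
      have h3 (x) : pd (gen (potential Ψ) u) i x = pd g i x + pd e i x := by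
        have h4 : gen (potential Ψ) u = fun y => (g y + e y) - c := by
          ext y; simp only [he]; ring
        rw [h4, pd_sub (by fun_prop) (by fun_prop), pd_add hg heT, pd_const, sub_zero]
      have i1 : Integrable (fun x => pd g i x * pd u i x) (gibbs (potential Ψ)) :=
        integrable_temperate hΨ hc (hgi.mul (hp i))
      have i2 : Integrable (fun x => pd e i x * pd u i x) (gibbs (potential Ψ)) :=
        integrable_temperate hΨ hc (hei.mul (hp i))
      simp only [h3, add_mul]
      rw [integral_add i1 i2, integral_pd_mul hΨ hc heT (hp i) i]
      have h5 := (abs_le.1 (abs_integral_mul_le (memLp_temperate hΨ hc hgi)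
        (memLp_temperate hΨ hc (hp i)) (inv_pos.2 hδ))).2
      have h6 := (abs_le.1 (abs_integral_mul_le heL
        (memLp_temperate hΨ hc (temperate_adj hΦ i (hp i))) (inv_pos.2 hη))).2
      rw [inv_inv] at h5 h6
      have h7 : η⁻¹ / 2 * ∫ x, e x ^ 2 ∂(gibbs (potential Ψ)) ≤ η / 2 := by
        calc _ ≤ η⁻¹ / 2 * η ^ 2 := by gcongr
          _ = _ := by field_simp
      have h8 := mul_le_mul_of_nonneg_left (hadj i) (half_pos hη).le
      linarith
    have h3 : ∑ i, r i ^ 2 * ∫ x, pd (gen (potential Ψ) u) i x * pd u i x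
        ∂(gibbs (potential Ψ)) ≤ δ⁻¹ / 2 * G + δ / 2 * X + η / 2 * (S * (1 + N)) := by
      refine (Finset.sum_le_sum fun i _ =>
        mul_le_mul_of_nonneg_left (h2 i) (sq_nonneg (r i))).trans_eq ?_
      rw [hG, hX, hS, Finset.sum_mul, Finset.mul_sum, Finset.mul_sum, Finset.mul_sum,
        ← Finset.sum_add_distrib, ← Finset.sum_add_distrib]
      exact Finset.sum_congr rfl fun i _ => by ring
    have h4 : δ * X ≤ δ⁻¹ * G + η * (S * (1 + N)) := by linarith
    have h5 := mul_le_mul_of_nonneg_left h4 (inv_pos.2 hδ).le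
    rw [inv_mul_cancel_left₀ hδ.ne'] at h5
    linarith
  have hcov : (∫ x, g x * h x ∂(gibbs (potential Ψ))) -
      (∫ x, g x ∂(gibbs (potential Ψ))) * m =
      ∑ i, ∫ x, pd h i x * pd u i x ∂(gibbs (potential Ψ)) -
        ∫ x, e x * (h x - m) ∂(gibbs (potential Ψ)) := by
    have i1 : Integrable (fun x => h x * gen (potential Ψ) u x) (gibbs (potential Ψ)) :=
      integrable_temperate hΨ hc (hh.mul hgen)
    have i2 : Integrable (fun x => e x * (h x - m)) (gibbs (potential Ψ)) :=
      integrable_temperate hΨ hc (by fun_prop)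
    have i3 : Integrable (fun x => g x * h x) (gibbs (potential Ψ)) :=
      integrable_temperate hΨ hc (hg.mul hh)
    have i4 := integrable_temperate hΨ hc hg
    have i5 := integrable_temperate hΨ hc hh
    have i6 := integrable_temperate hΨ hc hgen
    rw [← integral_mul_gen hΨ hc hu hh, ← integral_sub i1 i2, ← integral_mul_const,
      ← integral_sub i3 (i4.mul_const m)]
    have h1 : ∫ x, ((h x * gen (potential Ψ) u x - e x * (h x - m)) - (g x * h x - g x * m))
        ∂(gibbs (potential Ψ)) =
        ∫ x, (m * gen (potential Ψ) u x - c * (h x - m)) ∂(gibbs (potential Ψ)) :=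
      integral_congr_ae (Eventually.of_forall fun x => by simp only [he]; ring)
    have i7 : Integrable (fun x => h x * gen (potential Ψ) u x - e x * (h x - m))
      (gibbs (potential Ψ)) := i1.sub i2
    have i8 : Integrable (fun x => g x * h x - g x * m) (gibbs (potential Ψ)) :=
      i3.sub (i4.mul_const m)
    have i9 : Integrable (fun x => h x - m) (gibbs (potential Ψ)) := i5.sub (integrable_const m)
    rw [integral_sub i7 i8, integral_sub (i6.const_mul m) (i9.const_mul c), integral_const_mul, integral_const_mul,
      integral_gen hΨ hc hu, integral_sub i5 (integrable_const m)] at h1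
    simp only [integral_const, probReal_univ, smul_eq_mul, ← hm] at h1
    linarith
  rw [hcov]
  have h1 : |∑ i, ∫ x, pd h i x * pd u i x ∂(gibbs (potential Ψ))| ≤
      θ⁻¹ / 2 * H + θ / 2 * X := by
    rw [hH, hX, Finset.mul_sum, Finset.mul_sum, ← Finset.sum_add_distrib]
    refine (Finset.abs_sum_le_sum_abs _ _).trans (Finset.sum_le_sum fun i _ => ?_)
    have hri := hr i
    refine (abs_integral_mul_le (memLp_temperate hΨ hc (temperate_pd hh i))
      (memLp_temperate hΨ hc (hp i)) (θ := θ⁻¹ * (r i ^ 2)⁻¹) (by positivity)).trans_eq ?_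
    rw [mul_inv, inv_inv, inv_inv]
    ring
  have h2 : |∫ x, e x * (h x - m) ∂(gibbs (potential Ψ))| ≤ η / 2 + η / 2 * V := by
    have h3 : MemLp (fun x => h x - m) 2 (gibbs (potential Ψ)) :=
      memLp_temperate hΨ hc (by fun_prop)
    have h4 := abs_integral_mul_le heL h3 (inv_pos.2 hη)
    rw [inv_inv] at h4
    have h7 : η⁻¹ / 2 * ∫ x, e x ^ 2 ∂(gibbs (potential Ψ)) ≤ η / 2 := by
      calc _ ≤ η⁻¹ / 2 * η ^ 2 := by gcongr
        _ = _ := by field_simp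
    linarith
  have h3 := mul_le_mul_of_nonneg_left hXle (half_pos hθ).le
  refine (abs_sub _ _).trans ?_
  linarith

end WeightedEstimate

section Lattice

variable {d : ℕ}

lemma latDist_comm (i j : Fin d → ℤ) : latDist i j = latDist j i :=
  Finset.sum_congr rfl fun k _ => by rw [← Int.natAbs_neg, neg_sub]

lemma latDist_self (i : Fin d → ℤ) : latDist i i = 0 := by simp [latDist]

lemma latDist_triangle (i j k : Fin d → ℤ) : latDist i k ≤ latDist i j + latDist j k := by
  rw [latDist, latDist, latDist, ← Finset.sum_add_distrib]
  exact Finset.sum_le_sum fun l _ => by omega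

lemma latDistSet_nonneg (i : Fin d → ℤ) (S : Finset (Fin d → ℤ)) : 0 ≤ latDistSet i S :=
  Real.sInf_nonneg (by rintro _ ⟨j, -, rfl⟩; positivity)

lemma latDistSet_le {i j : Fin d → ℤ} {S : Finset (Fin d → ℤ)} (hj : j ∈ S) :
    latDistSet i S ≤ latDist i j :=
  csInf_le ⟨0, by rintro _ ⟨j, -, rfl⟩; positivity⟩ ⟨j, hj, rfl⟩

lemma latDistSet_eq_zero {i : Fin d → ℤ} {S : Finset (Fin d → ℤ)} (hi : i ∈ S) :
    latDistSet i S = 0 :=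
  le_antisymm ((latDistSet_le hi).trans (by simp [latDist_self])) (latDistSet_nonneg i S)

lemma latDistSet_le_add {S : Finset (Fin d → ℤ)} (hS : S.Nonempty) (i j : Fin d → ℤ) :
    latDistSet i S ≤ latDist i j + latDistSet j S := by
  rw [← sub_le_iff_le_add']
  refine le_csInf (hS.to_set.image _) ?_
  rintro _ ⟨k, hk, rfl⟩
  have h1 := latDistSet_le (i := i) hk
  have h2 : (latDist i k : ℝ) ≤ latDist i j + latDist j k := mod_cast latDist_triangle i j k
  simp only
  linarith

lemma latDistSets_le_latDistSet {S T : Finset (Fin d → ℤ)} (hS : S.Nonempty) {i : Fin d → ℤ}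
    (hi : i ∈ T) : latDistSets S T ≤ latDistSet i S := by
  refine le_csInf (hS.to_set.image _) ?_
  rintro _ ⟨j, hj, rfl⟩
  simp only [latDist_comm i j]
  exact csInf_le ⟨0, by rintro _ ⟨j, -, i, -, rfl⟩; positivity⟩ ⟨j, hj, i, hi, rfl⟩

end Lattice

lemma temperate_of_bounded_derivatives {g : EuclideanSpace ℝ Λ → ℝ} {C : ℕ → ℝ}
    (hg : ContDiff ℝ (⊤ : ℕ∞) g) (h : ∀ (n : ℕ) x, ‖iteratedFDeriv ℝ (n + 1) g x‖ ≤ C n) :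
    g.HasTemperateGrowth := by
  refine ⟨hg, fun n => ?_⟩
  cases n with
  | succ n => exact ⟨0, C n, fun x => by simpa using h n x⟩
  | zero =>
    have h1 (x) : ‖fderiv ℝ g x‖ ≤ C 0 := by
      rw [← norm_iteratedFDeriv_one]; exact h 0 x
    refine ⟨1, ‖g 0‖ + C 0, fun x => ?_⟩
    have h2 := convex_univ.norm_image_sub_le_of_norm_fderiv_le (𝕜 := ℝ) (f := g) (x := 0) (y := x)
      (fun y _ => hg.differentiable (by simp) y) (fun y _ => h1 y) trivial trivial
    have h3 := norm_le_norm_add_norm_sub' (g x) (g 0)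
    have h4 := (norm_nonneg _).trans (h1 0)
    rw [sub_zero] at h2
    rw [norm_iteratedFDeriv_zero, pow_one]
    nlinarith [norm_nonneg x, norm_nonneg (g 0), mul_nonneg (norm_nonneg x) (norm_nonneg (g 0))]

lemma pd_eq_zero_of_forall_eq {g : EuclideanSpace ℝ Λ → ℝ} {s : Set Λ}
    (hg : Differentiable ℝ g)
    (h : ∀ x y : EuclideanSpace ℝ Λ, (∀ i ∈ s, x i = y i) → g x = g y) {i : Λ} (hi : i ∉ s) (x) :
    pd g i x = 0 := by
  rw [pd, ← (hg x).lineDeriv_eq_fderiv, lineDeriv]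
  have h1 : (fun t : ℝ => g (x + t • EuclideanSpace.single i 1)) = fun _ => g x := by
    ext t
    refine h _ _ fun j hj => ?_
    have : j ≠ i := fun hji => hi (hji ▸ hj)
    simp [this]
  rw [h1, deriv_const]

lemma sum_mul_integral_sq_pd_le {Ψ : EuclideanSpace ℝ Λ → ℝ} (hΨ : ContDiff ℝ (⊤ : ℕ∞) Ψ)
    (hc : HasCompactSupport Ψ) {g : EuclideanSpace ℝ Λ → ℝ} (hg : g.HasTemperateGrowth) {C : ℝ}
    (hC : ∀ x, ‖fderiv ℝ g x‖ ≤ C) {b : ℝ} (hb : 0 ≤ b) {s : Λ → ℝ}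
    (hs : ∀ i, s i ≤ b ∨ ∀ x, pd g i x = 0) :
    ∑ i, s i * ∫ x, pd g i x ^ 2 ∂(gibbs (potential Ψ)) ≤ b * C ^ 2 := by
  have := isProbabilityMeasure_gibbs hΨ hc
  have hi (i : Λ) : Integrable (fun x => pd g i x ^ 2) (gibbs (potential Ψ)) :=
    integrable_temperate hΨ hc ((temperate_pd hg i).pow 2)
  calc ∑ i, s i * ∫ x, pd g i x ^ 2 ∂(gibbs (potential Ψ))
      ≤ ∑ i, b * ∫ x, pd g i x ^ 2 ∂(gibbs (potential Ψ)) := by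
        refine Finset.sum_le_sum fun i _ => ?_
        rcases hs i with h | h
        · exact mul_le_mul_of_nonneg_right h (integral_nonneg fun x => sq_nonneg _)
        · simp [h]
    _ = b * ∫ x, ∑ i, pd g i x ^ 2 ∂(gibbs (potential Ψ)) := by
        rw [← Finset.mul_sum, integral_finsetSum _ fun i _ => hi i]
    _ ≤ b * ∫ _, C ^ 2 ∂(gibbs (potential Ψ)) := by
        refine mul_le_mul_of_nonneg_left (integral_mono (integrable_finsetSum _ fun i _ => hi i)
          (integrable_const _) fun x => (sum_sq_pd_le g x).trans ?_) hb
        have := hC x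
        gcongr
    _ = b * C ^ 2 := by simp

end GibbsCovariance

/-- Exponential decay of the covariance: for `Φ = x²/2 + Ψ` with `Ψ`
smooth compactly supported, `g, h` smooth compactly supported with disjoint lattice
supports `Γ, Γ'`, under the conjugated-Hessian lower bound `M⁻¹(Hess Φ)M ≥ δ₀` for all
admissible exponential weights, `|cov(g,h)| ≤ C e^{−κ d(S_g,S_h)}` with `C, κ > 0`
independent of `Λ`. -/
theorem exponential_decay_of_covariance
    (d Ng Nh : ℕ) (lam δ₀ R : ℝ) (hlam : 0 < lam) (hδ₀ : 0 < δ₀) (hδ₀1 : δ₀ < 1)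
    (Cψ Cg Ch : ℕ → ℝ) :
    ∃ C κ : ℝ, 0 < C ∧ 0 < κ ∧
      ∀ (Λ Γ Γ' : Finset (Fin d → ℤ)),
        Γ ⊆ Λ → Γ' ⊆ Λ → Γ ≠ Λ → Γ' ≠ Λ → Γ.Nonempty → Γ'.Nonempty →
        Γ ∩ Γ' = ∅ → Γ.card ≤ Ng → Γ'.card ≤ Nh →
      ∀ Ψ g h : EuclideanSpace ℝ ↥Λ → ℝ,
        ContDiff ℝ (⊤ : ℕ∞) Ψ → HasCompactSupport Ψ →
        (∀ (n : ℕ) x, ‖iteratedFDeriv ℝ (n + 1) Ψ x‖ ≤ Cψ n) →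
        ContDiff ℝ (⊤ : ℕ∞) g → ContDiff ℝ (⊤ : ℕ∞) h →
        (∀ x y : EuclideanSpace ℝ ↥Λ, (∀ i : ↥Λ, ↑i ∈ Γ → x i = y i) → g x = g y) →
        (∀ x y : EuclideanSpace ℝ ↥Λ, (∀ i : ↥Λ, ↑i ∈ Γ' → x i = y i) → h x = h y) →
        (∀ x : EuclideanSpace ℝ ↥Λ, (∃ i : ↥Λ, ↑i ∈ Γ ∧ R ≤ |x i|) → g x = 0) →
        (∀ x : EuclideanSpace ℝ ↥Λ, (∃ i : ↥Λ, ↑i ∈ Γ' ∧ R ≤ |x i|) → h x = 0) →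
        (∀ (n : ℕ) x, ‖iteratedFDeriv ℝ (n + 1) g x‖ ≤ Cg n) →
        (∀ (n : ℕ) x, ‖iteratedFDeriv ℝ (n + 1) h x‖ ≤ Ch n) →
        -- the conjugated Hessian bound for every admissible exponential weight
        (∀ ρ : (Fin d → ℤ) → ℝ, (∀ i, 0 < ρ i) →
          (∀ i j : Fin d → ℤ, latDist i j = 1 →
            Real.exp (-lam) ≤ ρ i / ρ j ∧ ρ i / ρ j ≤ Real.exp lam) →
          ∀ (x : EuclideanSpace ℝ ↥Λ) (a : ↥Λ → ℝ),
            δ₀ * ∑ i, (a i) ^ 2 ≤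
              ∑ i : ↥Λ, ∑ j : ↥Λ, (ρ (↑i : Fin d → ℤ))⁻¹ *
                hess (fun y => ‖y‖ ^ 2 / 2 + Ψ y) x i j *
                ρ (↑j : Fin d → ℤ) * a i * a j) →
        |(∫ x, g x * h x ∂(gibbs (fun y => ‖y‖ ^ 2 / 2 + Ψ y))) -
            (∫ x, g x ∂(gibbs (fun y => ‖y‖ ^ 2 / 2 + Ψ y))) *
              (∫ x, h x ∂(gibbs (fun y => ‖y‖ ^ 2 / 2 + Ψ y)))| ≤
          C * Real.exp (-κ * latDistSets Γ Γ') := by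
  refine ⟨δ₀⁻¹ ^ 2 * Cg 0 ^ 2 / 2 + Ch 0 ^ 2 / 2 + 1, lam, by positivity, hlam, ?_⟩
  intro Λ Γ Γ' _ _ _ _ hΓ _ _ _ _ Ψ g h hΨ hc _ hg hh hgΓ hhΓ _ _ hCg hCh hess_ge
  have hgT := GibbsCovariance.temperate_of_bounded_derivatives hg hCg
  have hhT := GibbsCovariance.temperate_of_bounded_derivatives hh hCh
  set r : ↥Λ → ℝ := fun i => Real.exp (lam * latDistSet (i : Fin d → ℤ) Γ) with hr
  set D := latDistSets Γ Γ'
  have hone := hess_ge (fun _ => 1) (fun _ => one_pos)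
    (fun i j _ => by simp [hlam.le])
  have hweight := hess_ge (fun i => (Real.exp (lam * latDistSet i Γ))⁻¹)
    (fun i => inv_pos.2 (Real.exp_pos _)) fun i j hij => by
      have h1 := GibbsCovariance.latDistSet_le_add hΓ i j
      have h2 := GibbsCovariance.latDistSet_le_add hΓ j i
      rw [GibbsCovariance.latDist_comm j i] at h2
      rw [hij, Nat.cast_one] at h1 h2
      rw [← Real.exp_neg, ← Real.exp_neg, ← Real.exp_sub, Real.exp_le_exp, Real.exp_le_exp]
      constructor <;> nlinarith
  simp only [inv_one, one_mul, mul_one] at hone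
  simp only [inv_inv] at hweight
  refine (GibbsCovariance.abs_cov_le hΨ hc hδ₀ (r := r) (fun i => Real.exp_pos _) hone hweight
    hgT hhT (Real.exp_pos (-lam * D))).trans ?_
  have hG := GibbsCovariance.sum_mul_integral_sq_pd_le hΨ hc hgT (C := Cg 0)
    (fun x => by rw [← norm_iteratedFDeriv_one]; exact hCg 0 x) zero_le_one
    (s := fun i => r i ^ 2) fun i => by
      by_cases hi : (i : Fin d → ℤ) ∈ Γ
      · exact .inl (by simp [hr, GibbsCovariance.latDistSet_eq_zero hi])
      · exact .inr (GibbsCovariance.pd_eq_zero_of_forall_eq (s := {i : ↥Λ | (i : Fin d → ℤ) ∈ Γ})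
          (hg.differentiable (by simp)) hgΓ hi)
  have hH := GibbsCovariance.sum_mul_integral_sq_pd_le hΨ hc hhT (C := Ch 0)
    (fun x => by rw [← norm_iteratedFDeriv_one]; exact hCh 0 x)
    (b := Real.exp (-lam * D) ^ 2) (by positivity) (s := fun i => (r i ^ 2)⁻¹) fun i => by
      by_cases hi : (i : Fin d → ℤ) ∈ Γ'
      · refine .inl ?_
        have h1 := GibbsCovariance.latDistSets_le_latDistSet hΓ hi
        rw [← inv_pow, hr, ← Real.exp_neg, neg_mul]
        gcongr
      · exact .inr (GibbsCovariance.pd_eq_zero_of_forall_eq (s := {i : ↥Λ | (i : Fin d → ℤ) ∈ Γ'})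
          (hh.differentiable (by simp)) hhΓ hi)
  have hE := Real.exp_pos (-lam * D)
  set E := Real.exp (-lam * D)
  refine (add_le_add (mul_le_mul_of_nonneg_left (mul_le_mul_of_nonneg_left hG (by positivity))
    (by positivity)) (mul_le_mul_of_nonneg_left hH (by positivity))).trans ?_
  have h1 : E⁻¹ / 2 * (E ^ 2 * Ch 0 ^ 2) = E * (Ch 0 ^ 2 / 2) := by field_simp
  rw [h1]
  linarith
end
end
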